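/- Let f be an integral binary quartic form, irreducible over ℚ, with |Disc(f)| ≥ 2.71336712 × 10⁸⁰. Then the number of pairs (x,y) ∈ ℤ² with f(x,y) = ±1, counted up to the identification (x,y) ∼ (−x,−y), is at most 44. -/

import Mathlib

/-- Evaluation of the binary quartic form with coefficients `a, b, c, d, e` at `(x, y)`. -/
def quarticEval (a b c d e x y : ℤ) : ℤ :=
  a * x ^ 4 + b * x ^ 3 * y + c * x ^ 2 * y ^ 2 + d * x * y ^ 3 + e * y ^ 4

/-- The discriminant of the integral binary quartic form `ax⁴ + bx³y + cx²y² + dxy³ + ey⁴`. -/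
def quarticDisc (a b c d e : ℤ) : ℤ :=
  256 * a ^ 3 * e ^ 3 - 192 * a ^ 2 * b * d * e ^ 2 - 128 * a ^ 2 * c ^ 2 * e ^ 2
    + 144 * a ^ 2 * c * d ^ 2 * e - 27 * a ^ 2 * d ^ 4 + 144 * a * b ^ 2 * c * e ^ 2
    - 6 * a * b ^ 2 * d ^ 2 * e - 80 * a * b * c ^ 2 * d * e + 18 * a * b * c * d ^ 3
    + 16 * a * c ^ 4 * e - 4 * a * c ^ 3 * d ^ 2 - 27 * b ^ 4 * e ^ 2
    + 18 * b ^ 3 * c * d * e - 4 * b ^ 3 * d ^ 3 - 4 * b ^ 2 * c ^ 3 * e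
    + b ^ 2 * c ^ 2 * d ^ 2

open Polynomial in
/-- The dehomogenization `f(x,1)` (over `ℚ`) of the integral binary quartic form
`ax⁴ + bx³y + cx²y² + dxy³ + ey⁴`. -/
noncomputable def quarticPoly (a b c d e : ℤ) : Polynomial ℚ :=
  C (a : ℚ) * X ^ 4 + C (b : ℚ) * X ^ 3 + C (c : ℚ) * X ^ 2 + C (d : ℚ) * X + C (e : ℚ)

open Polynomial in
theorem eval_hasseDeriv_eq_sum {R : Type*} [CommRing R] (f : R[X]) {d : ℕ} (hd : f.natDegree ≤ d)
    (k : ℕ) (z : R) :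
    (hasseDeriv k f).eval z =
      ∑ i ∈ Finset.range (d + 1), f.coeff i * (i.choose k : R) * z ^ (i - k) := by
  rw [hasseDeriv_apply, f.sum_over_range' (by simp) (d + 1) (by omega), eval_finsetSum]
  refine Finset.sum_congr rfl fun i _ => ?_
  rw [eval_monomial]
  ring

theorem exists_pow_eq_sum_of_monic_quartic {b c d e : ℤ} {α : ℂ} {T : ℝ}
    (hα : α ^ 4 + b * α ^ 3 + c * α ^ 2 + d * α + e = 0)
    (hb : 1 + |(b : ℝ)| ≤ T) (hc : 1 + |(c : ℝ)| ≤ T) (hd : 1 + |(d : ℝ)| ≤ T)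
    (he : 1 + |(e : ℝ)| ≤ T) :
    ∃ r : ℕ → Fin 4 → ℤ, (∀ n, α ^ n = ∑ l, (r n l : ℂ) * α ^ (l : ℕ)) ∧
      ∀ n l, |(r n l : ℝ)| ≤ T ^ n := by
  have hT : 0 ≤ T := by linarith [abs_nonneg (b : ℝ)]
  have hT1 : 1 ≤ T := by linarith [abs_nonneg (b : ℝ)]
  obtain ⟨r, hr0, hr⟩ : ∃ r : ℕ → Fin 4 → ℤ, r 0 = ![1, 0, 0, 0] ∧ ∀ n, r (n + 1) =
      ![-(r n 3 * e), r n 0 - r n 3 * d, r n 1 - r n 3 * c, r n 2 - r n 3 * b] :=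
    ⟨fun n => Nat.rec ![1, 0, 0, 0]
      (fun _ v => ![-(v 3 * e), v 0 - v 3 * d, v 1 - v 3 * c, v 2 - v 3 * b]) n,
      rfl, fun _ => rfl⟩
  refine ⟨r, fun n => ?_, fun n => ?_⟩
  · induction n with
    | zero => simp [hr0, Fin.sum_univ_four]
    | succ n ih =>
      rw [pow_succ, ih, hr]
      simp only [Fin.sum_univ_four, Fin.isValue, Matrix.cons_val,
        Fin.coe_ofNat_eq_mod]
      push_cast
      linear_combination (r n 3 : ℂ) * hα
  · induction n with
    | zero => intro l; fin_cases l <;> simp [hr0]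
    | succ n ih =>
      have key (u v : ℝ) (w : ℤ) (hu : |u| ≤ T ^ n) (hv : |v| ≤ T ^ n) (hw : 1 + |(w : ℝ)| ≤ T) :
          |u - v * w| ≤ T ^ (n + 1) := by
        calc |u - v * w| ≤ |u| + |v| * |(w : ℝ)| := by
              rw [← abs_mul]; exact abs_sub _ _
          _ ≤ T ^ n + T ^ n * |(w : ℝ)| := by gcongr
          _ = T ^ n * (1 + |(w : ℝ)|) := by ring
          _ ≤ T ^ n * T := by gcongr
          _ = T ^ (n + 1) := by ring
      intro l
      rw [hr]
      fin_cases l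
      · have := key 0 (r n 3) e (by simp; positivity) (ih 3) he
        simpa using this
      · have := key (r n 0) (r n 3) d (ih 0) (ih 3) hd
        simpa using this
      · have := key (r n 1) (r n 3) c (ih 1) (ih 3) hc
        simpa using this
      · have := key (r n 2) (r n 3) b (ih 2) (ih 3) hb
        simpa using this

attribute [local instance] Matrix.seminormedAddCommGroup in
open Polynomial in
/-- Siegel's lemma, applied to the construction of a pair of integer polynomials `P`, `Q` such that
`P - α Q` vanishes to order `m` at the quartic integer `α`. -/
theorem exists_thue_polynomials {b c d e : ℤ} {α : ℂ} {T : ℝ}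
    (hα : α ^ 4 + b * α ^ 3 + c * α ^ 2 + d * α + e = 0)
    (hb : 1 + |(b : ℝ)| ≤ T) (hc : 1 + |(c : ℝ)| ≤ T) (hd : 1 + |(d : ℝ)| ≤ T)
    (he : 1 + |(e : ℝ)| ≤ T) {m s N : ℕ} (hm : 0 < m) (hs : 0 < s) (hN : N = 2 * m + s) :
    ∃ P Q : ℤ[X], (P ≠ 0 ∨ Q ≠ 0) ∧ P.natDegree < N ∧ Q.natDegree < N ∧
      (∀ i, |(P.coeff i : ℝ)| ≤ (2 * N * (2 ^ N * T ^ N)) ^ (2 * m / s : ℝ)) ∧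
      (∀ i, |(Q.coeff i : ℝ)| ≤ (2 * N * (2 ^ N * T ^ N)) ^ (2 * m / s : ℝ)) ∧
      ∀ k < m, (hasseDeriv k (P.map (Int.castRingHom ℂ) - C α * Q.map (Int.castRingHom ℂ))).eval α
        = 0 := by
  have hT1 : 1 ≤ T := by linarith [abs_nonneg (b : ℝ)]
  obtain ⟨r, hr, hrT⟩ := exists_pow_eq_sum_of_monic_quartic hα hb hc hd he
  let A : Matrix (Fin m × Fin 4) (Fin N ⊕ Fin N) ℤ := fun kl => Sum.elim
    (fun i => (i : ℕ).choose kl.1 * r (i - kl.1) kl.2)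
    (fun i => -((i : ℕ).choose kl.1 * r (i - kl.1 + 1) kl.2))
  have hA : ‖A‖ ≤ 2 ^ N * T ^ N := by
    have hch (i : Fin N) (k : ℕ) : (((i : ℕ).choose k : ℕ) : ℝ) ≤ 2 ^ N := by
      have h1 : (i : ℕ).choose k ≤ 2 ^ N :=
        (Nat.choose_le_two_pow _ _).trans (Nat.pow_le_pow_right (by norm_num) i.2.le)
      exact_mod_cast h1
    refine (Matrix.norm_le_iff (by positivity)).2 ?_
    rintro ⟨k, l⟩ (i | i)
    · simp only [A, Sum.elim_inl, Int.norm_eq_abs, Int.cast_mul, Int.cast_natCast, abs_mul,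
        Nat.abs_cast]
      exact mul_le_mul (hch _ _) ((hrT _ _).trans (pow_le_pow_right₀ hT1 (by omega)))
        (abs_nonneg _) (by positivity)
    · simp only [A, Sum.elim_inr, Int.norm_eq_abs, Int.cast_mul, Int.cast_natCast, abs_mul,
        Nat.abs_cast, Int.cast_neg, abs_neg]
      exact mul_le_mul (hch _ _) ((hrT _ _).trans (pow_le_pow_right₀ hT1 (by omega)))
        (abs_nonneg _) (by positivity)
  have hcol : Fintype.card (Fin N ⊕ Fin N) = 2 * N := by simp; ring
  have hrow : Fintype.card (Fin m × Fin 4) = 4 * m := by simp; ring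
  obtain ⟨t, ht0, htA, htn⟩ := Int.Matrix.exists_ne_zero_int_vec_norm_le A
    (by rw [hcol, hrow]; omega) (by rw [hrow]; omega)
  rw [hcol, hrow] at htn
  have hexp : ((4 * m : ℕ) : ℝ) / (((2 * N : ℕ) : ℝ) - ((4 * m : ℕ) : ℝ)) = 2 * m / s := by
    subst hN
    push_cast
    have : (s : ℝ) ≠ 0 := by positivity
    rw [show (2 * (2 * (m : ℝ) + s) - 4 * m) = 2 * s by ring, show (4 * (m : ℝ)) = 2 * (2 * m) by ring]
    rw [mul_div_mul_left _ _ two_ne_zero]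
  rw [hexp] at htn
  have htB : ‖t‖ ≤ (2 * N * (2 ^ N * T ^ N)) ^ (2 * m / s : ℝ) := by
    refine htn.trans (Real.rpow_le_rpow (by positivity) ?_ (by positivity))
    push_cast
    gcongr
    exact max_le (one_le_mul_of_one_le_of_one_le (one_le_pow₀ (by norm_num)) (one_le_pow₀ hT1)) hA
  have hB0 : 0 ≤ (2 * N * (2 ^ N * T ^ N)) ^ (2 * m / s : ℝ) := by positivity
  let P : ℤ[X] := ∑ i : Fin N, monomial (i : ℕ) (t (Sum.inl i))
  let Q : ℤ[X] := ∑ i : Fin N, monomial (i : ℕ) (t (Sum.inr i))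
  have hcoeff (u : Fin N → ℤ) (i : ℕ) : (∑ j : Fin N, monomial (j : ℕ) (u j)).coeff i =
      if h : i < N then u ⟨i, h⟩ else 0 := by
    rw [finsetSum_coeff]
    simp only [coeff_monomial]
    split_ifs with h
    · rw [Finset.sum_eq_single ⟨i, h⟩] <;> simp +contextual [Fin.ext_iff]
    · refine Finset.sum_eq_zero fun j _ => if_neg ?_
      have := j.2
      omega
  have hdeg (u : Fin N → ℤ) : (∑ j : Fin N, monomial (j : ℕ) (u j)).natDegree < N := by
    have : (∑ j : Fin N, monomial (j : ℕ) (u j)).natDegree ≤ N - 1 := by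
      refine natDegree_sum_le_of_forall_le _ _ fun j _ => (natDegree_monomial_le _).trans ?_
      have := j.2
      omega
    omega
  have hbd (u : Fin N → ℤ) (hu : ∀ i, |(u i : ℝ)| ≤ (2 * N * (2 ^ N * T ^ N)) ^ (2 * m / s : ℝ))
      (i : ℕ) : |((∑ j : Fin N, monomial (j : ℕ) (u j)).coeff i : ℝ)| ≤
        (2 * N * (2 ^ N * T ^ N)) ^ (2 * m / s : ℝ) := by
    rw [hcoeff]
    split_ifs with h
    · exact hu _
    · simpa using hB0
  refine ⟨P, Q, ?_, hdeg _, hdeg _, hbd _ ?_, hbd _ ?_, ?_⟩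
  · by_contra! h
    apply ht0
    funext i
    rcases i with i | i
    · have := hcoeff (fun i => t (Sum.inl i)) i
      rw [show (∑ j : Fin N, monomial (j : ℕ) (t (Sum.inl j))) = 0 from h.1] at this
      simpa using this.symm
    · have := hcoeff (fun i => t (Sum.inr i)) i
      rw [show (∑ j : Fin N, monomial (j : ℕ) (t (Sum.inr j))) = 0 from h.2] at this
      simpa using this.symm
  · intro i
    have := (norm_le_pi_norm t (Sum.inl i)).trans htB
    rwa [Int.norm_eq_abs] at this
  · intro i
    have := (norm_le_pi_norm t (Sum.inr i)).trans htB
    rwa [Int.norm_eq_abs] at this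
  · intro k hk
    have hPQ : P.map (Int.castRingHom ℂ) - C α * Q.map (Int.castRingHom ℂ) =
        ∑ i : Fin N, monomial (i : ℕ) ((t (Sum.inl i) : ℂ) - α * t (Sum.inr i)) := by
      simp only [P, Q, Polynomial.map_sum, Finset.mul_sum, map_monomial, C_mul_monomial,
        ← Finset.sum_sub_distrib, eq_intCast, ← map_sub]
    rw [hPQ, map_sum, eval_finsetSum]
    simp only [hasseDeriv_monomial, eval_monomial]
    have hrow (l : Fin 4) : ∑ i : Fin N, (((i : ℕ).choose k * r (i - k) l : ℤ) : ℂ) * t (Sum.inl i)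
        - ∑ i : Fin N, (((i : ℕ).choose k * r (i - k + 1) l : ℤ) : ℂ) * t (Sum.inr i) = 0 := by
      have h := congrFun htA (⟨k, hk⟩, l)
      simp only [Matrix.mulVec, dotProduct, Fintype.sum_sum_type, A, Sum.elim_inl, Sum.elim_inr,
        Pi.zero_apply, neg_mul, Finset.sum_neg_distrib, ← sub_eq_add_neg] at h
      exact_mod_cast h
    calc ∑ i : Fin N, ((i : ℕ).choose k : ℂ) * ((t (Sum.inl i) : ℂ) - α * t (Sum.inr i)) *
          α ^ ((i : ℕ) - k)
        = ∑ i : Fin N, (((i : ℕ).choose k : ℂ) * t (Sum.inl i) * α ^ ((i : ℕ) - k) -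
            ((i : ℕ).choose k : ℂ) * t (Sum.inr i) * α ^ ((i : ℕ) - k + 1)) := by
          refine Finset.sum_congr rfl fun i _ => ?_
          ring
      _ = ∑ i : Fin N, ∑ l : Fin 4, (((((i : ℕ).choose k * r (i - k) l : ℤ) : ℂ) * t (Sum.inl i)
            - (((i : ℕ).choose k * r (i - k + 1) l : ℤ) : ℂ) * t (Sum.inr i)) * α ^ (l : ℕ)) := by
          refine Finset.sum_congr rfl fun i _ => ?_
          rw [hr (i - k), hr (i - k + 1), Finset.mul_sum, Finset.mul_sum,
            ← Finset.sum_sub_distrib]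
          refine Finset.sum_congr rfl fun l _ => ?_
          push_cast
          ring
      _ = ∑ l : Fin 4, (∑ i : Fin N, (((i : ℕ).choose k * r (i - k) l : ℤ) : ℂ) * t (Sum.inl i)
            - ∑ i : Fin N, (((i : ℕ).choose k * r (i - k + 1) l : ℤ) : ℂ) * t (Sum.inr i)) *
              α ^ (l : ℕ) := by
          rw [Finset.sum_comm]
          refine Finset.sum_congr rfl fun l _ => ?_
          rw [← Finset.sum_sub_distrib, Finset.sum_mul]
      _ = 0 := Finset.sum_eq_zero fun l _ => by rw [hrow, zero_mul]

open Polynomial in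
theorem X_sub_C_pow_dvd_of_hasseDeriv_eq_zero {R : Type*} [CommRing R] {f : R[X]} {z : R} {n : ℕ}
    (h : ∀ k < n, (hasseDeriv k f).eval z = 0) : (X - C z) ^ n ∣ f := by
  rw [X_sub_C_pow_dvd_iff, ← taylor_apply, X_pow_dvd_iff]
  intro k hk
  rw [taylor_coeff, h k hk]

open Polynomial in
theorem pow_dvd_of_X_sub_C_pow_dvd_map {f : ℚ[X]} (hf : Irreducible f) {α : ℂ}
    (hα : aeval α f = 0) (k : ℕ) {g : ℚ[X]} (hg : (X - C α) ^ k ∣ g.map (algebraMap ℚ ℂ)) :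
    f ^ k ∣ g := by
  induction k generalizing g with
  | zero => simp
  | succ k ih =>
    have hsep : (f.map (algebraMap ℚ ℂ)).Separable := hf.separable.map
    have hroot : (f.map (algebraMap ℚ ℂ)).eval α = 0 := by rwa [eval_map_algebraMap]
    obtain ⟨h, hh⟩ := dvd_iff_isRoot.2 hroot
    have hcop : IsCoprime (X - C α) h := by
      rw [hh] at hsep
      exact hsep.isCoprime
    have hgroot : aeval α g = 0 := by
      have := (dvd_pow_self (X - C α) k.succ_ne_zero).trans hg
      rwa [dvd_iff_isRoot, IsRoot, eval_map_algebraMap] at this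
    have hfg : f ∣ g :=
      (Dvd.intro _ (minpoly.eq_of_irreducible hf hα)).trans (minpoly.dvd ℚ α hgroot)
    obtain ⟨g, rfl⟩ := hfg
    rw [pow_succ']
    refine mul_dvd_mul_left f (ih ?_)
    rw [Polynomial.map_mul, hh, pow_succ', mul_assoc] at hg
    have := (mul_dvd_mul_iff_left (X_sub_C_ne_zero α)).1 hg
    exact (hcop.pow_left (m := k)).dvd_of_dvd_mul_left this

open Polynomial in
theorem exists_C_mul_eq_of_wronskian_eq_zero {K : Type*} [Field K] [CharZero K] {P Q : K[X]}
    (h : wronskian P Q = 0) : ∃ (g : K[X]) (u v : K), P = C u * g ∧ Q = C v * g := by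
  classical
  by_cases h0 : P = 0 ∧ Q = 0
  · exact ⟨0, 0, 0, by simp [h0.1], by simp [h0.2]⟩
  obtain ⟨P', Q', hP, hQ, hu⟩ := extract_gcd P Q
  set g := gcd P Q with hg
  have hg0 : g ≠ 0 := by
    intro hz
    rw [hz, zero_mul] at hP hQ
    exact h0 ⟨hP, hQ⟩
  have hw : wronskian P' Q' = 0 := by
    have : g ^ 2 * wronskian P' Q' = 0 := by
      rw [← h, hP, hQ]
      simp only [wronskian, derivative_mul]
      ring
    simpa [hg0] using this
  have hc := (gcd_isUnit_iff P' Q').1 hu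
  obtain ⟨h1, h2⟩ := hc.wronskian_eq_zero_iff.1 hw
  refine ⟨g, P'.coeff 0, Q'.coeff 0, ?_, ?_⟩
  · rw [← eq_C_of_derivative_eq_zero h1, mul_comm]; exact hP
  · rw [← eq_C_of_derivative_eq_zero h2, mul_comm]; exact hQ

open Polynomial in
theorem exists_hasseDeriv_eval_ne_zero {f : ℚ[X]} (hf : Irreducible f) (hf4 : f.natDegree = 4)
    {α : ℂ} (hα : aeval α f = 0) {m s : ℕ} (hm : 0 < m) (hs : s ≤ 2 * m) {P Q : ℚ[X]}
    (hPQ : P ≠ 0 ∨ Q ≠ 0) (hP : P.natDegree < 2 * m + s) (hQ : Q.natDegree < 2 * m + s)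
    (hR : (X - C α) ^ m ∣ P.map (algebraMap ℚ ℂ) - C α * Q.map (algebraMap ℚ ℂ)) (z w : ℚ) :
    ∃ j ≤ 2 * s + 2, (hasseDeriv j (P - C w * Q)).eval z ≠ 0 := by
  have hrat (q : ℚ) : f.eval q ≠ 0 := by
    intro h
    have : f.natDegree = 1 := natDegree_eq_of_degree_eq_some (degree_eq_one_of_irreducible_of_root hf h)
    omega
  have hW0 : wronskian P Q ≠ 0 := by
    intro hW
    obtain ⟨g, u, v, rfl, rfl⟩ := exists_C_mul_eq_of_wronskian_eq_zero hW
    have huv : (algebraMap ℚ ℂ u - α * algebraMap ℚ ℂ v) ≠ 0 := by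
      intro h
      have hv : v ≠ 0 := by
        rintro rfl
        have : u = 0 := by simpa using h
        subst this
        simp at hPQ
      refine hrat (u / v) ?_
      have : α = algebraMap ℚ ℂ (u / v) := by
        rw [map_div₀, eq_div_iff (by simpa using hv)]
        linear_combination -h
      rw [this, aeval_algebraMap_apply] at hα
      simpa using hα
    have hdvd : (X - C α) ^ m ∣ g.map (algebraMap ℚ ℂ) := by
      have : (C u * g).map (algebraMap ℚ ℂ) - C α * (C v * g).map (algebraMap ℚ ℂ) =
          C (algebraMap ℚ ℂ u - α * algebraMap ℚ ℂ v) * g.map (algebraMap ℚ ℂ) := by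
        simp only [Polynomial.map_mul, map_C, map_sub, map_mul]
        ring
      rw [this] at hR
      exact ((isUnit_C.2 (isUnit_iff_ne_zero.2 huv)).dvd_mul_left).1 hR
    have hfg := pow_dvd_of_X_sub_C_pow_dvd_map hf hα m hdvd
    have hg0 : g ≠ 0 := by
      rintro rfl
      simp at hPQ
    have hgdeg := natDegree_le_of_dvd hfg hg0
    rw [natDegree_pow, hf4] at hgdeg
    rcases hPQ with h | h
    · rw [natDegree_C_mul (by rintro rfl; simp at h)] at hP
      omega
    · rw [natDegree_C_mul (by rintro rfl; simp at h)] at hQ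
      omega
  by_contra! hvan
  have hG : (X - C z) ^ (2 * s + 3) ∣ P - C w * Q :=
    X_sub_C_pow_dvd_of_hasseDeriv_eq_zero fun k hk => hvan k (by omega)
  have hzW : (X - C z) ^ (2 * s + 2) ∣ wronskian P Q := by
    have : wronskian P Q = (P - C w * Q) * derivative Q - derivative (P - C w * Q) * Q := by
      simp only [wronskian, derivative_sub, derivative_mul, derivative_C]
      ring
    rw [this]
    have h1 := pow_sub_one_dvd_derivative_of_pow_dvd hG
    rw [show 2 * s + 3 - 1 = 2 * s + 2 by omega] at h1
    have h2 := (pow_dvd_pow (X - C z) (show 2 * s + 2 ≤ 2 * s + 3 by omega)).trans hG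
    exact dvd_sub (h2.mul_right _) (h1.mul_right _)
  have hfW : f ^ (m - 1) ∣ wronskian P Q := by
    refine pow_dvd_of_X_sub_C_pow_dvd_map hf hα _ ?_
    have : (wronskian P Q).map (algebraMap ℚ ℂ) =
        (P.map (algebraMap ℚ ℂ) - C α * Q.map (algebraMap ℚ ℂ)) * derivative (Q.map (algebraMap ℚ ℂ))
        - derivative (P.map (algebraMap ℚ ℂ) - C α * Q.map (algebraMap ℚ ℂ)) *
          Q.map (algebraMap ℚ ℂ) := by
      simp only [wronskian, derivative_sub, derivative_mul, derivative_C, Polynomial.map_sub,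
        Polynomial.map_mul, derivative_map]
      ring
    rw [this]
    have h1 := pow_sub_one_dvd_derivative_of_pow_dvd hR
    have h2 := (pow_dvd_pow (X - C α) (show m - 1 ≤ m by omega)).trans hR
    exact dvd_sub (h2.mul_right _) (h1.mul_right _)
  have hcop : IsCoprime (f ^ (m - 1)) ((X - C z) ^ (2 * s + 2)) := by
    refine IsCoprime.pow (IsCoprime.symm ?_)
    refine (irreducible_X_sub_C z).coprime_iff_not_dvd.2 ?_
    rw [dvd_iff_isRoot]
    exact hrat z
  have hdeg := natDegree_le_of_dvd (hcop.mul_dvd hfW hzW) hW0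
  rw [natDegree_mul (pow_ne_zero _ hf.ne_zero) (pow_ne_zero _ (X_sub_C_ne_zero z)), natDegree_pow,
    natDegree_pow, natDegree_X_sub_C, hf4] at hdeg
  have := natDegree_wronskian_lt_add hW0
  omega

open Polynomial in
theorem norm_eval_hasseDeriv_le {f : ℂ[X]} {N : ℕ} (hf : f.natDegree < N) {B T : ℝ} (hT : 1 ≤ T)
    (hB : ∀ i, ‖f.coeff i‖ ≤ B) {z : ℂ} (hz : ‖z‖ ≤ T) (j : ℕ) :
    ‖(hasseDeriv j f).eval z‖ ≤ N * (B * 2 ^ N * T ^ N) := by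
  have hB0 : 0 ≤ B := (norm_nonneg _).trans (hB 0)
  rw [eval_hasseDeriv_eq_sum f (show f.natDegree ≤ N - 1 by omega), Nat.sub_add_cancel (by omega)]
  refine (norm_sum_le_of_le (s := Finset.range N) (f := _) (fun i hi => ?_)).trans_eq
    (b := ∑ _i ∈ Finset.range N, B * 2 ^ N * T ^ N) (by simp)
  rw [Finset.mem_range] at hi
  rw [norm_mul, norm_mul, norm_pow, Complex.norm_natCast]
  have h1 : ((i.choose j : ℕ) : ℝ) ≤ 2 ^ N := by
    exact_mod_cast (Nat.choose_le_two_pow i j).trans (Nat.pow_le_pow_right (by norm_num) hi.le)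
  have h2 : ‖z‖ ^ (i - j) ≤ T ^ N :=
    (pow_le_pow_left₀ (norm_nonneg _) hz _).trans (pow_le_pow_right₀ hT (by omega))
  exact mul_le_mul (mul_le_mul (hB i) h1 (by positivity) hB0) h2 (by positivity) (by positivity)

open Polynomial in
theorem norm_eval_hasseDeriv_le_of_vanishing {f : ℂ[X]} {N : ℕ} (hf : f.natDegree < N) {B T : ℝ}
    (hT : 1 ≤ T) (hB : ∀ i, ‖f.coeff i‖ ≤ B) {α z : ℂ} (hα : ‖α‖ ≤ T) {m : ℕ}
    (hvan : ∀ k < m, (hasseDeriv k f).eval α = 0) (hz : ‖z - α‖ ≤ 1) {j : ℕ} :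
    ‖(hasseDeriv j f).eval z‖ ≤ N ^ 2 * (B * 4 ^ N * T ^ N) * ‖z - α‖ ^ (m - j) := by
  have hB0 : 0 ≤ B := (norm_nonneg _).trans (hB 0)
  have hz' : taylor z f = taylor (z - α) (taylor α f) := by
    rw [taylor_taylor, sub_add_cancel]
  rw [← taylor_coeff, hz', taylor_coeff, eval_hasseDeriv_eq_sum (d := N - 1) _
    (by rw [natDegree_taylor]; omega), Nat.sub_add_cancel (by omega)]
  refine (norm_sum_le_of_le (s := Finset.range N) (f := _) (fun i hi => ?_)).trans_eq
    (b := ∑ _i ∈ Finset.range N, (N * (B * 2 ^ N * T ^ N)) * 2 ^ N * ‖z - α‖ ^ (m - j)) ?_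
  · rw [Finset.mem_range] at hi
    rw [taylor_coeff, norm_mul, norm_mul, norm_pow, Complex.norm_natCast]
    rcases lt_or_ge i m with him | him
    · rw [hvan i him]
      simp only [norm_zero, zero_mul]
      positivity
    · have h1 : ((i.choose j : ℕ) : ℝ) ≤ 2 ^ N := by
        exact_mod_cast (Nat.choose_le_two_pow i j).trans (Nat.pow_le_pow_right (by norm_num) hi.le)
      have h2 : ‖z - α‖ ^ (i - j) ≤ ‖z - α‖ ^ (m - j) :=
        pow_le_pow_of_le_one (norm_nonneg _) hz (by omega)
      exact mul_le_mul (mul_le_mul (norm_eval_hasseDeriv_le hf hT hB hα i) h1 (by positivity)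
        (by positivity)) h2 (by positivity) (by positivity)
  · rw [Finset.sum_const, Finset.card_range, nsmul_eq_mul, show (4 : ℝ) = 2 * 2 by norm_num, mul_pow]
    ring

open Polynomial in
theorem one_le_mul_abs_eval_hasseDeriv {P Q : ℤ[X]} {N : ℕ} (hP : P.natDegree < N)
    (hQ : Q.natDegree < N) {x₁ y₁ x₂ y₂ : ℤ} (hy₁ : 0 < y₁) (hy₂ : 0 < y₂) {j : ℕ} (hj : j < N)
    (hne : (hasseDeriv j (P.map (Int.castRingHom ℚ) -
      C ((x₂ : ℚ) / y₂) * Q.map (Int.castRingHom ℚ))).eval ((x₁ : ℚ) / y₁) ≠ 0) :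
    (1 : ℝ) ≤ (y₁ : ℝ) ^ (N - 1 - j) * y₂ *
      ‖(hasseDeriv j (P.map (Int.castRingHom ℂ) -
        C ((x₂ : ℂ) / y₂) * Q.map (Int.castRingHom ℂ))).eval ((x₁ : ℂ) / y₁)‖ := by
  set G : ℚ[X] := P.map (Int.castRingHom ℚ) - C ((x₂ : ℚ) / y₂) * Q.map (Int.castRingHom ℚ) with hG
  have hmap : P.map (Int.castRingHom ℂ) - C ((x₂ : ℂ) / y₂) * Q.map (Int.castRingHom ℂ) =
      G.map (algebraMap ℚ ℂ) := by
    simp only [hG, Polynomial.map_sub, Polynomial.map_mul, Polynomial.map_map, map_C, map_div₀]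
    congr
  have hGdeg : G.natDegree ≤ N - 1 := by
    refine (natDegree_sub_le _ _).trans (max_le ((natDegree_map_le).trans (by omega)) ?_)
    exact (natDegree_C_mul_le _ _).trans ((natDegree_map_le).trans (by omega))
  have hy₁' : (y₁ : ℚ) ≠ 0 := by exact_mod_cast hy₁.ne'
  have hy₂' : (y₂ : ℚ) ≠ 0 := by exact_mod_cast hy₂.ne'
  obtain ⟨I, hI⟩ : ∃ I : ℤ, (I : ℚ) =
      (y₁ : ℚ) ^ (N - 1 - j) * y₂ * (hasseDeriv j G).eval ((x₁ : ℚ) / y₁) := by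
    refine ⟨∑ i ∈ Finset.range (N - 1 + 1), (i.choose j : ℤ) * (P.coeff i * y₂ - x₂ * Q.coeff i) *
      (x₁ ^ (i - j) * y₁ ^ (N - 1 - j - (i - j))), ?_⟩
    rw [eval_hasseDeriv_eq_sum G hGdeg, Finset.mul_sum]
    push_cast
    refine Finset.sum_congr rfl fun i hi => ?_
    rw [Finset.mem_range] at hi
    rcases lt_or_ge i j with hij | hij
    · simp [Nat.choose_eq_zero_of_lt hij]
    · have hpow : (y₁ : ℚ) ^ (N - 1 - j) = y₁ ^ (i - j) * y₁ ^ (N - 1 - j - (i - j)) := by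
        rw [← pow_add]; congr 1; omega
      rw [hpow, div_pow, hG]
      simp only [coeff_sub, coeff_map, coeff_C_mul, eq_intCast]
      field_simp
  have hI0 : I ≠ 0 := by
    rintro rfl
    have := hI.symm
    simp only [Int.cast_zero, mul_eq_zero, hy₂', or_false, hne] at this
    exact pow_ne_zero _ hy₁' this
  have h1 : (1 : ℝ) ≤ |(I : ℝ)| := by exact_mod_cast Int.one_le_abs hI0
  have heval : (hasseDeriv j (G.map (algebraMap ℚ ℂ))).eval ((x₁ : ℂ) / y₁) =
      (((hasseDeriv j G).eval ((x₁ : ℚ) / y₁) : ℚ) : ℂ) := by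
    rw [← taylor_coeff, ← taylor_coeff,
      show ((x₁ : ℂ) / y₁) = algebraMap ℚ ℂ ((x₁ : ℚ) / y₁) by simp, ← map_taylor, coeff_map]
    simp
  rw [hmap, heval]
  have hI' : (I : ℂ) = (y₁ : ℂ) ^ (N - 1 - j) * y₂ *
      (((hasseDeriv j G).eval ((x₁ : ℚ) / y₁) : ℚ) : ℂ) := by exact_mod_cast congrArg (Rat.cast (K := ℂ)) hI
  have hnorm := congrArg norm hI'
  rw [norm_mul, norm_mul, norm_pow, Complex.norm_intCast, Complex.norm_intCast,
    Complex.norm_intCast, abs_of_pos (show (0 : ℝ) < y₁ by exact_mod_cast hy₁),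
    abs_of_pos (show (0 : ℝ) < y₂ by exact_mod_cast hy₂)] at hnorm
  rwa [← hnorm]

/-- The numerical contradiction closing Thue's argument, in terms of `t = log T`, `u = log y₁` and
`v = log y₂`. -/
theorem thue_exponents {t u v l : ℝ} {m s j : ℕ} (ht : 0 < t) (hl : 44 * l ≤ t)
    (hu : 242 * t ≤ u) (hm : 33 ≤ m) (hs : s = (m + 11) / 12) (hj : j ≤ 2 * s + 2)
    (hv₁ : 4 * m * u ≤ 5 * v) (hv₂ : 5 * v ≤ 4 * (m + 1) * u) {γ : ℝ}
    (hγ : γ ≤ 2 * m / s * ((2 * m + s) * (2 * l + t)) + (2 * m + s) * (4 * l) + (2 * m + s + 1) * t) :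
    l + (2 * m + s - 1 - j) * u + v + γ + (m - j) * (2 * t - 4 * u) < 0 ∧
      l + (2 * m + s - 1 - j) * u + v + γ + (2 * t - 4 * v) < 0 := by
  have hs0 : 1 ≤ s := by omega
  have hs1 : m ≤ 12 * s := by omega
  have hs2 : 12 * s ≤ m + 11 := by omega
  have hs0' : (1 : ℝ) ≤ s := by exact_mod_cast hs0
  have hs1' : (m : ℝ) ≤ 12 * s := by exact_mod_cast hs1
  have hs2' : 12 * (s : ℝ) ≤ m + 11 := by exact_mod_cast hs2
  have hm' : (33 : ℝ) ≤ m := by exact_mod_cast hm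
  have hj' : (j : ℝ) ≤ 2 * s + 2 := by exact_mod_cast hj
  have hj0 : (0 : ℝ) ≤ j := by positivity
  have hγ' : γ ≤ 56 * m * t := by
    have h1 : 2 * m / s * ((2 * m + s) : ℝ) ≤ 50 * m := by
      rw [div_mul_eq_mul_div, div_le_iff₀ (by linarith)]
      nlinarith
    have h2 : 2 * l + t ≤ 23 / 22 * t := by linarith
    have h3 : 2 * m / s * ((2 * m + s) * (2 * l + t)) ≤ 50 * m * (23 / 22 * t) := by
      rw [← mul_assoc]
      exact (mul_le_mul_of_nonneg_left h2 (by positivity)).trans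
        (mul_le_mul_of_nonneg_right h1 (by positivity))
    have h4 : (2 * m + s : ℝ) * (4 * l) ≤ (2 * m + s) * (t / 11) :=
      mul_le_mul_of_nonneg_left (by linarith) (by positivity)
    nlinarith
  constructor
  · have hA : 0 ≤ 1.2 * (m : ℝ) - 7 * s - 5.8 := by linarith
    have hB : 58 * (m : ℝ) + 1 < (1.2 * (m : ℝ) - 7 * s - 5.8) * 242 := by
      rcases le_or_gt s 3 with h | h
      · have : (s : ℝ) ≤ 3 := by exact_mod_cast h
        linarith
      · have : (4 : ℝ) ≤ s := by exact_mod_cast h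
        linarith
    have h1 : (1.2 * (m : ℝ) - 7 * s - 5.8) * (242 * t) ≤ (1.2 * (m : ℝ) - 7 * s - 5.8) * u :=
      mul_le_mul_of_nonneg_left hu hA
    have h2 : (58 * (m : ℝ) + 1) * t < (1.2 * (m : ℝ) - 7 * s - 5.8) * 242 * t :=
      mul_lt_mul_of_pos_right hB ht
    have h3 : (j : ℝ) * (3 * u - 2 * t) ≤ (2 * s + 2) * (3 * u - 2 * t) :=
      mul_le_mul_of_nonneg_right hj' (by linarith)
    have h4 : 0 ≤ (s : ℝ) * t := by positivity
    nlinarith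
  · have h1 : 0 ≤ (j : ℝ) * u := mul_nonneg hj0 (by linarith)
    have h2 : (s - 1 : ℝ) * u ≤ (m - 1) / 12 * u :=
      mul_le_mul_of_nonneg_right (by linarith) (by linarith)
    have h3 : (m : ℝ) * (242 * t) ≤ m * u := mul_le_mul_of_nonneg_left hu (by positivity)
    nlinarith

open Polynomial in
theorem natDegree_quarticPoly {a : ℤ} (ha : a ≠ 0) (b c d e : ℤ) :
    (quarticPoly a b c d e).natDegree = 4 := by
  have ha' : (a : ℚ) ≠ 0 := by exact_mod_cast ha
  unfold quarticPoly
  compute_degree!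

open Polynomial in
theorem aeval_quarticPoly (a b c d e : ℤ) (α : ℂ) :
    aeval α (quarticPoly a b c d e) = a * α ^ 4 + b * α ^ 3 + c * α ^ 2 + d * α + e := by
  simp [quarticPoly]

set_option maxHeartbeats 2000000 in
open Polynomial in
/-- Thue's method: a quartic integer has no two very good rational approximations whose
denominators are both large and far apart. -/
theorem false_of_two_large_approximations {b c d e : ℤ} (hirr : Irreducible (quarticPoly 1 b c d e))
    {α : ℂ} (hα : α ^ 4 + b * α ^ 3 + c * α ^ 2 + d * α + e = 0) {T : ℝ} (hT : 2 ^ 44 ≤ T)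
    (hb : 1 + |(b : ℝ)| ≤ T) (hc : 1 + |(c : ℝ)| ≤ T) (hd : 1 + |(d : ℝ)| ≤ T)
    (he : 1 + |(e : ℝ)| ≤ T) (hαT : 1 + ‖α‖ ≤ T) {x₁ y₁ x₂ y₂ : ℤ} (hy₁ : T ^ 242 ≤ y₁)
    (hy₂ : 0 < y₂) (hy : (y₁ : ℝ) ^ 132 ≤ (y₂ : ℝ) ^ 5)
    (h₁ : ‖(x₁ : ℂ) / y₁ - α‖ ≤ T ^ 2 / (y₁ : ℝ) ^ 4)
    (h₂ : ‖(x₂ : ℂ) / y₂ - α‖ ≤ T ^ 2 / (y₂ : ℝ) ^ 4) : False := by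
  have hT1 : 1 ≤ T := le_trans (by norm_num) hT
  have hT0 : 0 < T := by linarith
  have hy₁0 : (0 : ℝ) < y₁ := lt_of_lt_of_le (by positivity) hy₁
  have hy₁0' : 0 < y₁ := by exact_mod_cast hy₁0
  have hy₂0 : (0 : ℝ) < y₂ := by exact_mod_cast hy₂
  obtain ⟨t, htT⟩ : ∃ t, Real.exp t = T := ⟨Real.log T, Real.exp_log hT0⟩
  obtain ⟨u, huy⟩ : ∃ u, Real.exp u = y₁ := ⟨Real.log y₁, Real.exp_log hy₁0⟩
  obtain ⟨v, hvy⟩ : ∃ v, Real.exp v = y₂ := ⟨Real.log y₂, Real.exp_log hy₂0⟩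
  obtain ⟨l, hl2⟩ : ∃ l, Real.exp l = 2 := ⟨Real.log 2, Real.exp_log two_pos⟩
  have hl0 : 0 < l := by
    rw [← Real.exp_lt_exp, hl2, Real.exp_zero]; norm_num
  have hlt : 44 * l ≤ t := by
    rw [← Real.exp_le_exp, htT]
    refine le_trans (le_of_eq ?_) hT
    rw [← hl2, ← Real.exp_nat_mul]; norm_num
  have ht0 : 0 < t := by linarith
  have hut : 242 * t ≤ u := by
    rw [← Real.exp_le_exp, huy]
    refine le_trans (le_of_eq ?_) hy₁
    rw [← htT, ← Real.exp_nat_mul]; norm_num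
  have hu0 : 0 < u := by linarith
  have huv : 132 * u ≤ 5 * v := by
    rw [← huy, ← hvy, ← Real.exp_nat_mul, ← Real.exp_nat_mul, Real.exp_le_exp] at hy
    exact_mod_cast hy
  obtain ⟨m, hm33, hm₁, hm₂⟩ : ∃ m : ℕ, 33 ≤ m ∧ 4 * m * u ≤ 5 * v ∧ 5 * v ≤ 4 * (m + 1) * u := by
    have h0 : 0 ≤ 5 * v / (4 * u) := div_nonneg (by linarith) (by linarith)
    refine ⟨⌊5 * v / (4 * u)⌋₊, ?_, ?_, ?_⟩
    · refine Nat.le_floor ?_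
      rw [le_div_iff₀ (by linarith)]
      push_cast
      linarith
    · have := Nat.floor_le h0
      rw [le_div_iff₀ (by linarith)] at this
      linarith
    · have := (Nat.lt_floor_add_one (5 * v / (4 * u))).le
      rw [div_le_iff₀ (by linarith)] at this
      linarith
  obtain ⟨s, hs⟩ : ∃ s, s = (m + 11) / 12 := ⟨_, rfl⟩
  obtain ⟨N, hN⟩ : ∃ N, N = 2 * m + s := ⟨_, rfl⟩
  obtain ⟨P, Q, hPQ, hPN, hQN, hPB, hQB, hvan⟩ :=
    exists_thue_polynomials hα hb hc hd he (m := m) (s := s) (by omega) (by omega) hN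
  set B : ℝ := (2 * N * (2 ^ N * T ^ N)) ^ (2 * m / s : ℝ) with hB
  have hf4 := natDegree_quarticPoly one_ne_zero b c d e
  have hroot : aeval α (quarticPoly 1 b c d e) = 0 := by
    rw [aeval_quarticPoly, ← hα]; push_cast; ring
  have hcast : (algebraMap ℚ ℂ).comp (Int.castRingHom ℚ) = Int.castRingHom ℂ := by ext; simp
  obtain ⟨j, hj, hne⟩ := exists_hasseDeriv_eval_ne_zero hirr hf4 hroot (m := m) (s := s)
    (P := P.map (Int.castRingHom ℚ)) (Q := Q.map (Int.castRingHom ℚ)) (by omega) (by omega)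
    (by
      have hinj : Function.Injective (Int.castRingHom ℚ) := Int.cast_injective
      simpa only [ne_eq, Polynomial.map_eq_zero_iff hinj] using hPQ)
    (natDegree_map_le.trans_lt (by omega)) (natDegree_map_le.trans_lt (by omega))
    (by
      rw [Polynomial.map_map, Polynomial.map_map, hcast]
      exact X_sub_C_pow_dvd_of_hasseDeriv_eq_zero hvan)
    ((x₁ : ℚ) / y₁) ((x₂ : ℚ) / y₂)
  have hone := one_le_mul_abs_eval_hasseDeriv hPN hQN hy₁0' hy₂ (by omega) hne
  set R := P.map (Int.castRingHom ℂ) - C α * Q.map (Int.castRingHom ℂ) with hR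
  have hsplit : P.map (Int.castRingHom ℂ) - C ((x₂ : ℂ) / y₂) * Q.map (Int.castRingHom ℂ) =
      R - ((x₂ : ℂ) / y₂ - α) • Q.map (Int.castRingHom ℂ) := by
    rw [smul_eq_C_mul, C_sub, hR]; ring
  have hB0 : 0 ≤ B := by positivity
  have hδ : T ^ 2 / (y₁ : ℝ) ^ 4 = Real.exp (2 * t - 4 * u) := by
    rw [← htT, ← huy, Real.exp_sub, ← Real.exp_nat_mul, ← Real.exp_nat_mul]; norm_num
  have hδ₂ : T ^ 2 / (y₂ : ℝ) ^ 4 = Real.exp (2 * t - 4 * v) := by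
    rw [← htT, ← hvy, Real.exp_sub, ← Real.exp_nat_mul, ← Real.exp_nat_mul]; norm_num
  rw [hδ] at h₁
  rw [hδ₂] at h₂
  have hz1 : ‖(x₁ : ℂ) / y₁ - α‖ ≤ 1 := h₁.trans (Real.exp_le_one_iff.2 (by linarith))
  have hzT : ‖(x₁ : ℂ) / y₁‖ ≤ T := by
    calc ‖(x₁ : ℂ) / y₁‖ = ‖((x₁ : ℂ) / y₁ - α) + α‖ := by ring_nf
      _ ≤ ‖(x₁ : ℂ) / y₁ - α‖ + ‖α‖ := norm_add_le _ _
      _ ≤ T := by linarith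
  have hQc (i : ℕ) : ‖(Q.map (Int.castRingHom ℂ)).coeff i‖ ≤ B := by
    rw [coeff_map, eq_intCast, Complex.norm_intCast]; exact hQB i
  have hRc (i : ℕ) : ‖R.coeff i‖ ≤ B * T := by
    rw [hR, coeff_sub, coeff_C_mul, coeff_map, coeff_map, eq_intCast, eq_intCast]
    calc ‖(P.coeff i : ℂ) - α * Q.coeff i‖ ≤ ‖(P.coeff i : ℂ)‖ + ‖α * Q.coeff i‖ := norm_sub_le _ _
      _ ≤ B + ‖α‖ * B := by
        rw [norm_mul, Complex.norm_intCast, Complex.norm_intCast]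
        gcongr
        · exact hPB i
        · exact hQB i
      _ = B * (1 + ‖α‖) := by ring
      _ ≤ B * T := by gcongr
  have hRN : R.natDegree < N := by
    refine (natDegree_sub_le _ _).trans_lt (max_lt (natDegree_map_le.trans_lt hPN) ?_)
    exact (natDegree_C_mul_le _ _).trans_lt (natDegree_map_le.trans_lt hQN)
  have hαT' : ‖α‖ ≤ T := by linarith
  have hboundR := norm_eval_hasseDeriv_le_of_vanishing hRN hT1 hRc hαT' hvan hz1 (j := j)
  have hboundQ := norm_eval_hasseDeriv_le (natDegree_map_le.trans_lt hQN) hT1 hQc hzT j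
  obtain ⟨γ, hγ⟩ : ∃ γ : ℝ, γ = 2 * m / s * ((2 * m + s) * (2 * l + t)) + (2 * m + s) * (4 * l) +
    (2 * m + s + 1) * t := ⟨_, rfl⟩
  have hNr : (N : ℝ) = 2 * m + s := by rw [hN]; push_cast; ring
  have hpow2 (k : ℕ) : (2 : ℝ) ^ k = Real.exp (k * l) := by rw [← hl2, ← Real.exp_nat_mul]
  have hpowT (k : ℕ) : T ^ k = Real.exp (k * t) := by rw [← htT, ← Real.exp_nat_mul]
  have hN2 : (2 * N : ℝ) ≤ 2 ^ N := by
    have h1 : N - 1 < 2 ^ (N - 1) := Nat.lt_two_pow_self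
    have h2 : 2 ^ N = 2 * 2 ^ (N - 1) := by rw [← pow_succ']; congr 1; omega
    have h3 : 2 * N ≤ 2 ^ N := by omega
    exact_mod_cast h3
  have hBγ : B ≤ Real.exp (2 * m / s * ((2 * m + s) * (2 * l + t))) := by
    rw [hB, mul_comm (2 * (m : ℝ) / s) _, Real.exp_mul]
    refine Real.rpow_le_rpow (by positivity) ?_ (by positivity)
    calc 2 * (N : ℝ) * (2 ^ N * T ^ N) ≤ 2 ^ N * (2 ^ N * T ^ N) := by gcongr
      _ = Real.exp ((2 * m + s) * (2 * l + t)) := by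
        rw [hpow2, hpowT, ← Real.exp_add, ← Real.exp_add, hNr]; ring_nf
  have hCγ : (N : ℝ) ^ 2 * ((B * T) * 4 ^ N * T ^ N) ≤ Real.exp γ := by
    calc (N : ℝ) ^ 2 * ((B * T) * 4 ^ N * T ^ N)
        ≤ (2 ^ N) ^ 2 * ((Real.exp (2 * m / s * ((2 * m + s) * (2 * l + t))) * T) * 4 ^ N * T ^ N) := by
          gcongr
          linarith
      _ = Real.exp γ := by
          rw [show (4 : ℝ) = 2 ^ 2 by norm_num, ← pow_mul, ← pow_mul, hpow2, hpow2, hpowT, ← htT,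
            ← Real.exp_add, ← Real.exp_add, ← Real.exp_add, ← Real.exp_add, hγ]
          push_cast
          rw [hNr]
          ring_nf
  have hCQ : (N : ℝ) * (B * 2 ^ N * T ^ N) ≤ Real.exp γ := by
    refine le_trans ?_ hCγ
    have hN1 : (1 : ℝ) ≤ N := by exact_mod_cast (show 1 ≤ N by omega)
    have e1 : (N : ℝ) ≤ N ^ 2 := by nlinarith
    have e2 : B ≤ B * T := le_mul_of_one_le_right hB0 hT1
    gcongr
    norm_num
  obtain ⟨hfin₁, hfin₂⟩ := thue_exponents ht0 hlt hut hm33 hs hj hm₁ hm₂ hγ.le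
  have hpref : (y₁ : ℝ) ^ (N - 1 - j) * y₂ = Real.exp ((2 * m + s - 1 - j) * u + v) := by
    rw [← huy, ← hvy, ← Real.exp_nat_mul, ← Real.exp_add, Nat.cast_sub (by omega),
      Nat.cast_sub (by omega), hNr]
    simp
  have hmj : ‖(x₁ : ℂ) / y₁ - α‖ ^ (m - j) ≤ Real.exp ((m - j) * (2 * t - 4 * u)) := by
    refine (pow_le_pow_left₀ (norm_nonneg _) h₁ _).trans_eq ?_
    rw [← Real.exp_nat_mul, Nat.cast_sub (by omega)]
  have htotal : ‖(hasseDeriv j (P.map (Int.castRingHom ℂ) -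
      C ((x₂ : ℂ) / y₂) * Q.map (Int.castRingHom ℂ))).eval ((x₁ : ℂ) / y₁)‖ ≤
      Real.exp γ * Real.exp ((m - j) * (2 * t - 4 * u)) +
        Real.exp (2 * t - 4 * v) * Real.exp γ := by
    rw [hsplit, map_sub, map_smul, eval_sub, eval_smul, smul_eq_mul]
    refine (norm_sub_le _ _).trans (add_le_add (hboundR.trans ?_) ?_)
    · gcongr
    · rw [norm_mul]
      exact mul_le_mul h₂ (hboundQ.trans hCQ) (norm_nonneg _) (Real.exp_pos _).le
  rw [hpref] at hone
  have hone' := hone.trans (mul_le_mul_of_nonneg_left htotal (Real.exp_pos _).le)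
  rw [mul_add, ← Real.exp_add, ← Real.exp_add, ← Real.exp_add, ← Real.exp_add] at hone'
  rw [← Real.exp_lt_one_iff] at hfin₁ hfin₂
  have e1 : Real.exp (l + (2 * m + s - 1 - j) * u + v + γ + (m - j) * (2 * t - 4 * u)) =
      2 * Real.exp ((2 * m + s - 1 - j) * u + v + (γ + (m - j) * (2 * t - 4 * u))) := by
    rw [← hl2, ← Real.exp_add]; ring_nf
  have e2 : Real.exp (l + (2 * m + s - 1 - j) * u + v + γ + (2 * t - 4 * v)) =
      2 * Real.exp ((2 * m + s - 1 - j) * u + v + (2 * t - 4 * v + γ)) := by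
    rw [← hl2, ← Real.exp_add]; ring_nf
  linarith

theorem exists_card_le_one_prod_lt {ι : Type*} [DecidableEq ι] (S : Finset ι) (q w : ι → ℝ) {Y : ℝ}
    (hY : 1 < Y) (hq : ∀ x ∈ S, 1 ≤ q x) (hqY : ∀ x ∈ S, q x < Y)
    (hgap : ∀ x ∈ S, ∀ y ∈ S, x ≠ y → 1 < w x → 1 < w y → q x ≤ q y → w x * q x ≤ q y) :
    ∃ M : Finset ι, M.card ≤ 1 ∧ ∀ S' ⊆ S \ M, ∏ x ∈ S', max 1 (w x) < Y := by
  have key : ∀ C ⊆ S.filter (fun x => 1 < w x), C.Nonempty →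
      ∃ z ∈ C, (∀ x ∈ C, q x ≤ q z) ∧ ∏ x ∈ C.erase z, w x ≤ q z := by
    intro C
    induction C using Finset.induction_on_max_value q with
    | empty => intro _ h; simp at h
    | insert a s has hmax ih =>
      intro hC _
      have haS := Finset.mem_filter.1 (hC (Finset.mem_insert_self a s))
      refine ⟨a, Finset.mem_insert_self a s, ?_, ?_⟩
      · simpa using hmax
      · rw [Finset.erase_insert has]
        rcases s.eq_empty_or_nonempty with rfl | hs
        · simpa using hq a haS.1
        · obtain ⟨z, hz, -, hprod⟩ := ih ((Finset.subset_insert a s).trans hC) hs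
          have hzS := Finset.mem_filter.1 (hC (Finset.mem_insert_of_mem hz))
          rw [← Finset.mul_prod_erase s w hz]
          refine (mul_le_mul_of_nonneg_left hprod (by linarith [hzS.2])).trans ?_
          exact hgap z hzS.1 a haS.1 (by rintro rfl; exact has hz) hzS.2 haS.2 (hmax z hz)
  rcases (S.filter (fun x => 1 < w x)).eq_empty_or_nonempty with hE | hE
  · refine ⟨∅, by simp, fun S' hS' => ?_⟩
    rw [Finset.prod_congr rfl (g := fun _ => 1), Finset.prod_const_one]
    · exact hY
    · intro x hx
      have hxS : x ∈ S := by simpa using hS' hx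
      refine max_eq_left (not_lt.1 fun h => ?_)
      have : x ∈ S.filter (fun x => 1 < w x) := Finset.mem_filter.2 ⟨hxS, h⟩
      simp [hE] at this
  · obtain ⟨z, hz, -, hprod⟩ := key _ subset_rfl hE
    refine ⟨{z}, by simp, fun S' hS' => lt_of_le_of_lt ?_ (hqY z (Finset.mem_filter.1 hz).1)⟩
    refine le_trans ?_ hprod
    calc ∏ x ∈ S', max 1 (w x) = ∏ x ∈ S'.filter (fun x => 1 < w x), max 1 (w x) := by
          rw [Finset.prod_filter]
          refine Finset.prod_congr rfl fun x _ => ?_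
          split_ifs with h
          · rfl
          · exact max_eq_left (not_lt.1 h)
      _ = ∏ x ∈ S'.filter (fun x => 1 < w x), w x :=
          Finset.prod_congr rfl fun x hx => max_eq_right (Finset.mem_filter.1 hx).2.le
      _ ≤ ∏ x ∈ (S.filter (fun x => 1 < w x)).erase z, w x := by
          refine Finset.prod_le_prod_of_subset_of_one_le (fun x hx => ?_) (fun x hx => ?_)
            (fun x hx _ => ?_)
          · obtain ⟨h1, h2⟩ := Finset.mem_filter.1 hx
            have := hS' h1
            simp only [Finset.mem_sdiff, Finset.mem_singleton] at this
            exact Finset.mem_erase.2 ⟨this.2, Finset.mem_filter.2 ⟨this.1, h2⟩⟩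
          · linarith [(Finset.mem_filter.1 hx).2]
          · exact (Finset.mem_filter.1 (Finset.mem_of_mem_erase hx)).2.le

/-- The linear forms `p - βq` and `p' - βq'` cannot both be small. -/
theorem one_le_gap (β : ℂ) {p q p' q' : ℤ} (hq : 0 < q) (hq' : 0 < q') (h : p * q' - p' * q ≠ 0) :
    (1 : ℝ) ≤ q' * ‖(p : ℂ) - β * q‖ + q * ‖(p' : ℂ) - β * q'‖ := by
  have h1 : (1 : ℝ) ≤ ‖((p * q' - p' * q : ℤ) : ℂ)‖ := by
    rw [Complex.norm_intCast]; exact_mod_cast Int.one_le_abs h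
  have e : ((p * q' - p' * q : ℤ) : ℂ) = q' * (p - β * q) - q * (p' - β * q') := by
    push_cast; ring
  rw [e] at h1
  refine h1.trans ((norm_sub_le _ _).trans_eq ?_)
  rw [norm_mul, norm_mul, Complex.norm_intCast, Complex.norm_intCast,
    abs_of_pos (show (0 : ℝ) < q' by exact_mod_cast hq'),
    abs_of_pos (show (0 : ℝ) < q by exact_mod_cast hq)]

theorem card_small_le {β : Fin 4 → ℂ} {T : ℝ} (hT : 512 < T) (S : Finset (ℤ × ℤ))
    (hq : ∀ x ∈ S, 0 < x.2) (hqY : ∀ x ∈ S, (x.2 : ℝ) < (T / 512) ^ 2)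
    (hdet : ∀ x ∈ S, ∀ y ∈ S, x ≠ y → x.1 * y.2 - y.1 * x.2 ≠ 0)
    (hpos : ∀ x ∈ S, ∀ i, 0 < ‖(x.1 : ℂ) - β i * x.2‖)
    (hmin : ∀ x ∈ S, T / 512 ≤ ∏ i, max 1 (1 / (2 * (x.2 * ‖(x.1 : ℂ) - β i * x.2‖)))) :
    S.card ≤ 11 := by
  have hT1 : 1 < T / 512 := by linarith
  have hY : 1 < (T / 512) ^ 2 := one_lt_pow₀ hT1 two_ne_zero
  have hex (i : Fin 4) := exists_card_le_one_prod_lt S (fun x => (x.2 : ℝ))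
    (fun x => 1 / (2 * (x.2 * ‖(x.1 : ℂ) - β i * x.2‖))) hY
    (fun x hx => by exact_mod_cast hq x hx) hqY (by
      intro x hx y hy hxy hwx hwy hle
      have hx0 : (0 : ℝ) < x.2 := by exact_mod_cast hq x hx
      have hy0 : (0 : ℝ) < y.2 := by exact_mod_cast hq y hy
      have hLx := hpos x hx i
      have hLy := hpos y hy i
      have hg := one_le_gap (β i) (hq x hx) (hq y hy) (hdet x hx y hy hxy)
      rw [lt_div_iff₀ (by positivity), one_mul] at hwy
      rw [div_mul_eq_mul_div, div_le_iff₀ (by positivity), one_mul]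
      have : x.2 * ‖(y.1 : ℂ) - β i * y.2‖ ≤ y.2 * ‖(y.1 : ℂ) - β i * y.2‖ := by gcongr
      have h2 : (1 : ℝ) ≤ 2 * (y.2 * ‖(x.1 : ℂ) - β i * x.2‖) := by linarith
      nlinarith)
  choose M hM hprod using hex
  set S' := S \ Finset.univ.biUnion M with hS'
  have h7 : S'.card < 8 := by
    rw [← pow_lt_pow_iff_right₀ hT1]
    calc (T / 512) ^ S'.card
        = ∏ x ∈ S', (T / 512) := (Finset.prod_const _).symm
      _ ≤ ∏ x ∈ S', ∏ i, max 1 (1 / (2 * (x.2 * ‖(x.1 : ℂ) - β i * x.2‖))) :=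
          Finset.prod_le_prod (fun _ _ => by linarith)
            fun x hx => hmin x (Finset.mem_sdiff.1 hx).1
      _ = ∏ i, ∏ x ∈ S', max 1 (1 / (2 * (x.2 * ‖(x.1 : ℂ) - β i * x.2‖))) := Finset.prod_comm
      _ < ∏ i : Fin 4, (T / 512) ^ 2 := by
          refine Finset.prod_lt_prod_of_nonempty (fun i _ => ?_) (fun i _ => ?_)
            Finset.univ_nonempty
          · exact Finset.prod_pos fun x _ => lt_max_of_lt_left one_pos
          · exact hprod i S' (Finset.sdiff_subset_sdiff subset_rfl
              (Finset.subset_biUnion_of_mem M (Finset.mem_univ i)))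
      _ = (T / 512) ^ 8 := by simp; ring
  have h4 : (Finset.univ.biUnion M).card ≤ 4 :=
    Finset.card_biUnion_le.trans ((Finset.sum_le_sum fun i _ => hM i).trans_eq (by simp))
  have h := Finset.card_le_card_sdiff_add_card (s := S) (t := Finset.univ.biUnion M)
  rw [← hS'] at h
  omega

theorem card_large_le {b c d e : ℤ} (hirr : Irreducible (quarticPoly 1 b c d e)) {α : ℂ}
    (hα : α ^ 4 + b * α ^ 3 + c * α ^ 2 + d * α + e = 0) {T : ℝ} (hT : 10 ^ 40 ≤ T ^ 3)
    (hb : 1 + |(b : ℝ)| ≤ T) (hc : 1 + |(c : ℝ)| ≤ T) (hd : 1 + |(d : ℝ)| ≤ T)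
    (he : 1 + |(e : ℝ)| ≤ T) (hαT : 1 + ‖α‖ ≤ T) (S : Finset (ℤ × ℤ))
    (hq : ∀ x ∈ S, (T / 512) ^ 2 ≤ (x.2 : ℝ))
    (hdet : ∀ x ∈ S, ∀ y ∈ S, x ≠ y → x.1 * y.2 - y.1 * x.2 ≠ 0)
    (hα' : ∀ x ∈ S, ‖(x.1 : ℂ) - α * x.2‖ ≤ 8 * T ^ 2 / (10 ^ 40 * (x.2 : ℝ) ^ 3)) :
    S.card ≤ 8 := by
  have hT44 : (2 : ℝ) ^ 44 ≤ T := by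
    by_contra! h
    have hT0 : 0 ≤ T := by linarith [norm_nonneg α]
    have := pow_le_pow_left₀ hT0 h.le 3
    norm_num at this hT
    linarith
  have hTn : (17592186044416 : ℝ) ≤ T := by norm_num at hT44; exact hT44
  have hT0 : 0 < T := by linarith
  have hq0 : ∀ x ∈ S, 0 < x.2 := fun x hx => by
    have : (0 : ℝ) < x.2 := lt_of_lt_of_le (by positivity) (hq x hx)
    exact_mod_cast this
  have hgap : ∀ x ∈ S, ∀ y ∈ S, x ≠ y → x.2 ≤ y.2 →
      10 ^ 40 * (x.2 : ℝ) ^ 3 ≤ 16 * T ^ 2 * y.2 := by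
    intro x hx y hy hxy hle
    have hx0 : (0 : ℝ) < x.2 := by exact_mod_cast hq0 x hx
    have hle' : (x.2 : ℝ) ≤ y.2 := by exact_mod_cast hle
    have hy0 : (0 : ℝ) < y.2 := by linarith
    have hg := one_le_gap α (hq0 x hx) (hq0 y hy) (hdet x hx y hy hxy)
    have h1 : (x.2 : ℝ) * ‖(y.1 : ℂ) - α * y.2‖ ≤ y.2 * (8 * T ^ 2 / (10 ^ 40 * (x.2 : ℝ) ^ 3)) := by
      refine mul_le_mul hle' ((hα' y hy).trans ?_) (norm_nonneg _) hy0.le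
      gcongr
    have h2 : (y.2 : ℝ) * ‖(x.1 : ℂ) - α * x.2‖ ≤ y.2 * (8 * T ^ 2 / (10 ^ 40 * (x.2 : ℝ) ^ 3)) := by
      gcongr
      exact hα' x hx
    have h3 : (1 : ℝ) ≤ 16 * T ^ 2 * y.2 / (10 ^ 40 * (x.2 : ℝ) ^ 3) := by
      refine (hg.trans (add_le_add h2 h1)).trans_eq ?_
      ring
    rwa [le_div_iff₀ (by positivity), one_mul] at h3
  have hstep {u v : ℝ} (hu : (T / 512) ^ 2 ≤ u) (huv : 10 ^ 40 * u ^ 3 ≤ 16 * T ^ 2 * v) : u < v := by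
    have hu0 : 0 < u := lt_of_lt_of_le (by positivity) hu
    by_contra! hvu
    have h1 : 10 ^ 40 * u ^ 3 ≤ 16 * T ^ 2 * u := huv.trans (by gcongr)
    have h2 : (10 ^ 40 * u ^ 2) * u ≤ (16 * T ^ 2) * u := by linarith
    have h3 := le_of_mul_le_mul_right h2 hu0
    have h4 : 10 ^ 40 * ((T / 512) ^ 2) ^ 2 ≤ 16 * T ^ 2 := le_trans (by gcongr) h3
    have h5 : 10 ^ 40 / 512 ^ 4 * T ^ 2 * T ^ 2 ≤ 16 * T ^ 2 := by linarith
    have h6 := le_of_mul_le_mul_right h5 (by positivity)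
    nlinarith
  by_contra! hcard
  have hinj : Set.InjOn (fun x : ℤ × ℤ => x.2) S := by
    intro x hx y hy hxy
    by_contra hne
    have := hstep (hq x hx) (hgap x hx y hy hne (le_of_eq hxy))
    dsimp only at hxy
    rw [hxy] at this
    exact lt_irrefl _ this
  obtain ⟨S', hS', hcard'⟩ := Finset.exists_subset_card_eq (s := S.image fun x => x.2) (n := 9)
    (by rw [Finset.card_image_of_injOn hinj]; omega)
  set g := S'.orderEmbOfFin hcard' with hg
  have hz (k : Fin 9) : ∃ x ∈ S, x.2 = g k :=
    Finset.mem_image.1 (hS' (S'.orderEmbOfFin_mem hcard' k))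
  choose z hzS hzg using hz
  have hzgap (k l : Fin 9) (hkl : k < l) :
      10 ^ 40 * ((z k).2 : ℝ) ^ 3 ≤ 16 * T ^ 2 * (z l).2 := by
    have hlt : (z k).2 < (z l).2 := by
      rw [hzg, hzg]; exact g.strictMono hkl
    exact hgap _ (hzS k) _ (hzS l) (by intro h; rw [h] at hlt; exact lt_irrefl _ hlt) hlt.le
  have hwstep (n : ℕ) {u v : ℝ} (hu : T ^ n ≤ 10 ^ 20 * u / (4 * T))
      (huv : 10 ^ 40 * u ^ 3 ≤ 16 * T ^ 2 * v) : T ^ (n * 3) ≤ 10 ^ 20 * v / (4 * T) := by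
    rw [pow_mul]
    refine (pow_le_pow_left₀ (by positivity) hu 3).trans ?_
    rw [div_pow, mul_pow, div_le_div_iff₀ (by positivity) (by positivity)]
    calc (10 ^ 20) ^ 3 * u ^ 3 * (4 * T) = 10 ^ 20 * (4 * T) * (10 ^ 40 * u ^ 3) := by ring
      _ ≤ 10 ^ 20 * (4 * T) * (16 * T ^ 2 * v) := by gcongr
      _ = 10 ^ 20 * v * (4 * T) ^ 3 := by ring
  have hw0 : T ^ 1 ≤ 10 ^ 20 * ((z 0).2 : ℝ) / (4 * T) := by
    rw [le_div_iff₀ (by positivity)]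
    have := hq _ (hzS 0)
    nlinarith
  have hw1 := hwstep _ hw0 (hzgap 0 1 (by decide))
  have hw2 := hwstep _ hw1 (hzgap 1 2 (by decide))
  have hw3 := hwstep _ hw2 (hzgap 2 3 (by decide))
  have hw4 := hwstep _ hw3 (hzgap 3 4 (by decide))
  have hw5 := hwstep _ hw4 (hzgap 4 5 (by decide))
  have hpos (k : Fin 9) : (0 : ℝ) < (z k).2 := by exact_mod_cast hq0 _ (hzS k)
  have hy₁ : T ^ 242 ≤ ((z 5).2 : ℝ) := by
    rw [le_div_iff₀ (by positivity)] at hw5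
    have h1 : T ^ 242 * 10 ^ 20 ≤ T ^ (1 * 3 * 3 * 3 * 3 * 3) * (4 * T) := by
      have : T ^ (1 * 3 * 3 * 3 * 3 * 3) * (4 * T) = T ^ 242 * (4 * T ^ 2) := by ring
      rw [this]
      gcongr
      nlinarith
    linarith
  have hcube {u v : ℝ} (hu : 0 < u) (huv : 10 ^ 40 * u ^ 3 ≤ 16 * T ^ 2 * v) :
      (u / T) ^ 3 ≤ v / T := by
    rw [div_pow, div_le_div_iff₀ (by positivity) hT0]
    have h1 : u ^ 3 ≤ T ^ 2 * v := by nlinarith [pow_pos hu 3]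
    nlinarith
  have hc6 := hcube (hpos 5) (hzgap 5 6 (by decide))
  have hc7 := hcube (hpos 6) (hzgap 6 7 (by decide))
  have hc8 := hcube (hpos 7) (hzgap 7 8 (by decide))
  have h27 : (((z 5).2 : ℝ) / T) ^ 27 ≤ (z 8).2 / T := by
    have h5 := hpos 5
    have h6 := hpos 6
    calc (((z 5).2 : ℝ) / T) ^ 27 = (((((z 5).2 : ℝ) / T) ^ 3) ^ 3) ^ 3 := by ring
      _ ≤ ((((z 6).2 : ℝ) / T) ^ 3) ^ 3 := by gcongr
      _ ≤ (((z 7).2 : ℝ) / T) ^ 3 := by gcongr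
      _ ≤ _ := hc8
  have hy : ((z 5).2 : ℝ) ^ 132 ≤ ((z 8).2 : ℝ) ^ 5 := by
    have h5 := hpos 5
    have h1 := pow_le_pow_left₀ (by positivity) h27 5
    rw [← pow_mul, div_pow, div_pow, div_le_div_iff₀ (by positivity) (by positivity)] at h1
    have h2 : T ^ 130 ≤ ((z 5).2 : ℝ) ^ 3 := by
      calc T ^ 130 ≤ T ^ (242 * 3) := pow_le_pow_right₀ (by linarith) (by norm_num)
        _ = (T ^ 242) ^ 3 := by rw [pow_mul]
        _ ≤ _ := by gcongr
    have h3 : ((z 5).2 : ℝ) ^ 132 * T ^ 135 ≤ ((z 8).2 : ℝ) ^ 5 * T ^ 135 := by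
      calc ((z 5).2 : ℝ) ^ 132 * T ^ 135 = ((z 5).2 : ℝ) ^ 132 * T ^ 130 * T ^ 5 := by ring
        _ ≤ ((z 5).2 : ℝ) ^ 132 * ((z 5).2 : ℝ) ^ 3 * T ^ 5 := by gcongr
        _ = ((z 5).2 : ℝ) ^ (27 * 5) * T ^ 5 := by ring
        _ ≤ _ := h1
    exact le_of_mul_le_mul_right h3 (by positivity)
  have happrox (k : Fin 9) : ‖((z k).1 : ℂ) / (z k).2 - α‖ ≤ T ^ 2 / ((z k).2 : ℝ) ^ 4 := by
    have hk := hpos k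
    have hk' : ((z k).2 : ℂ) ≠ 0 := by
      have := (hq0 _ (hzS k)).ne'
      exact_mod_cast this
    have e1 : ((z k).1 : ℂ) / (z k).2 - α = ((z k).1 - α * (z k).2) / (z k).2 := by
      field_simp
    rw [e1, norm_div, Complex.norm_intCast, abs_of_pos hk, div_le_iff₀ hk]
    refine (hα' _ (hzS k)).trans ?_
    rw [div_le_iff₀ (by positivity), div_mul_eq_mul_div, div_mul_eq_mul_div,
      le_div_iff₀ (by positivity)]
    have : 0 < T ^ 2 * ((z k).2 : ℝ) ^ 4 := by positivity
    nlinarith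
  exact false_of_two_large_approximations hirr hα hT44 hb hc hd he hαT hy₁ (hq0 _ (hzS 8)) hy
    (happrox 5) (happrox 8)

theorem coeff_bounds_of_factorization {b c d e : ℤ} {β : Fin 4 → ℂ}
    (hfac : ∀ z w : ℂ, z ^ 4 + b * z ^ 3 * w + c * z ^ 2 * w ^ 2 + d * z * w ^ 3 + e * w ^ 4 =
      ∏ i, (z - β i * w)) :
    1 + |(b : ℝ)| ≤ ∏ i, (1 + ‖β i‖) ∧ 1 + |(c : ℝ)| ≤ ∏ i, (1 + ‖β i‖) ∧
      1 + |(d : ℝ)| ≤ ∏ i, (1 + ‖β i‖) ∧ 1 + |(e : ℝ)| ≤ ∏ i, (1 + ‖β i‖) := by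
  simp only [Fin.prod_univ_four] at hfac ⊢
  have h0 := hfac 0 1
  have h1 := hfac 1 1
  have h2 := hfac (-1) 1
  have h3 := hfac 2 1
  have he : (e : ℂ) = β 0 * β 1 * β 2 * β 3 := by linear_combination h0
  have hc : (c : ℂ) = β 0 * β 1 + β 0 * β 2 + β 0 * β 3 + β 1 * β 2 + β 1 * β 3 + β 2 * β 3 := by
    linear_combination h1 / 2 + h2 / 2 - h0
  have hb : (b : ℂ) = -(β 0 + β 1 + β 2 + β 3) := by
    linear_combination (h3 - h0 - 4 * (h1 / 2 + h2 / 2 - h0)) / 6 - (h1 / 2 - h2 / 2) / 3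
  have hd : (d : ℂ) = -(β 0 * β 1 * β 2 + β 0 * β 1 * β 3 + β 0 * β 2 * β 3 + β 1 * β 2 * β 3) := by
    linear_combination (h1 - h2) / 2 - hb
  have n0 := norm_nonneg (β 0)
  have n1 := norm_nonneg (β 1)
  have n2 := norm_nonneg (β 2)
  have n3 := norm_nonneg (β 3)
  rw [← Complex.norm_intCast, ← Complex.norm_intCast, ← Complex.norm_intCast,
    ← Complex.norm_intCast, hb, hc, hd, he, norm_neg, norm_neg]
  refine ⟨?_, ?_, ?_, ?_⟩
  · have : ‖β 0 + β 1 + β 2 + β 3‖ ≤ ‖β 0‖ + ‖β 1‖ + ‖β 2‖ + ‖β 3‖ := norm_add₄_le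
    refine (add_le_add_right this 1).trans (sub_nonneg.1 ?_)
    ring_nf
    positivity
  · have : ‖β 0 * β 1 + β 0 * β 2 + β 0 * β 3 + β 1 * β 2 + β 1 * β 3 + β 2 * β 3‖ ≤
        ‖β 0‖ * ‖β 1‖ + ‖β 0‖ * ‖β 2‖ + ‖β 0‖ * ‖β 3‖ + ‖β 1‖ * ‖β 2‖ + ‖β 1‖ * ‖β 3‖ +
          ‖β 2‖ * ‖β 3‖ := by
      refine (norm_add_le_of_le (norm_add_le_of_le norm_add₄_le le_rfl) le_rfl).trans_eq ?_
      simp only [norm_mul]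
    refine (add_le_add_right this 1).trans (sub_nonneg.1 ?_)
    ring_nf
    positivity
  · have : ‖β 0 * β 1 * β 2 + β 0 * β 1 * β 3 + β 0 * β 2 * β 3 + β 1 * β 2 * β 3‖ ≤
        ‖β 0‖ * ‖β 1‖ * ‖β 2‖ + ‖β 0‖ * ‖β 1‖ * ‖β 3‖ + ‖β 0‖ * ‖β 2‖ * ‖β 3‖ +
          ‖β 1‖ * ‖β 2‖ * ‖β 3‖ := by
      refine norm_add₄_le.trans_eq ?_
      simp only [norm_mul]
    refine (add_le_add_right this 1).trans (sub_nonneg.1 ?_)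
    ring_nf
    positivity
  · simp only [norm_mul]
    refine sub_nonneg.1 ?_
    ring_nf
    positivity

theorem norm_sub_le_one_add_mul (z w : ℂ) : ‖z - w‖ ≤ (1 + ‖z‖) * (1 + ‖w‖) := by
  have := norm_sub_le z w
  nlinarith [norm_nonneg z, norm_nonneg w]

theorem norm_root_diff_mul_le {β γ p : ℂ} {q : ℝ} (hq : 0 < q) (h : ‖p - β * q‖ ≤ ‖p - γ * q‖) :
    ‖β - γ‖ * q ≤ 2 * ‖p - γ * q‖ := by
  have e : (β - γ) * q = (p - γ * q) - (p - β * q) := by ring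
  calc ‖β - γ‖ * q = ‖(β - γ) * q‖ := by rw [norm_mul, Complex.norm_of_nonneg hq.le]
    _ ≤ ‖p - γ * q‖ + ‖p - β * q‖ := by rw [e]; exact norm_sub_le _ _
    _ ≤ _ := by linarith

/-- If the linear form `p - β₀q` is the smallest of four whose product has norm one, then it is
bounded in terms of the product of the distances between the `βᵢ`. -/
theorem norm_min_form_le {β₀ β₁ β₂ β₃ p : ℂ} {q T : ℝ} (hq : 0 < q)
    (hT : T = (1 + ‖β₀‖) * (1 + ‖β₁‖) * (1 + ‖β₂‖) * (1 + ‖β₃‖))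
    (hD : 10 ^ 40 ≤ ‖β₀ - β₁‖ * ‖β₀ - β₂‖ * ‖β₀ - β₃‖ * (‖β₁ - β₂‖ * ‖β₁ - β₃‖ * ‖β₂ - β₃‖))
    (hprod : ‖p - β₀ * q‖ * ‖p - β₁ * q‖ * ‖p - β₂ * q‖ * ‖p - β₃ * q‖ = 1)
    (h₁ : ‖p - β₀ * q‖ ≤ ‖p - β₁ * q‖) (h₂ : ‖p - β₀ * q‖ ≤ ‖p - β₂ * q‖)
    (h₃ : ‖p - β₀ * q‖ ≤ ‖p - β₃ * q‖) :
    ‖p - β₀ * q‖ ≤ 8 * T ^ 2 / (10 ^ 40 * q ^ 3) := by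
  have d₁ := norm_root_diff_mul_le hq h₁
  have d₂ := norm_root_diff_mul_le hq h₂
  have d₃ := norm_root_diff_mul_le hq h₃
  have n0 := norm_nonneg β₀
  have n1 := norm_nonneg β₁
  have n2 := norm_nonneg β₂
  have n3 := norm_nonneg β₃
  have hT2 : ‖β₁ - β₂‖ * ‖β₁ - β₃‖ * ‖β₂ - β₃‖ ≤ T ^ 2 := by
    calc ‖β₁ - β₂‖ * ‖β₁ - β₃‖ * ‖β₂ - β₃‖
        ≤ ((1 + ‖β₁‖) * (1 + ‖β₂‖)) * ((1 + ‖β₁‖) * (1 + ‖β₃‖)) * ((1 + ‖β₂‖) * (1 + ‖β₃‖)) := by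
          gcongr <;> exact norm_sub_le_one_add_mul _ _
      _ = 1 ^ 2 * ((1 + ‖β₁‖) * (1 + ‖β₂‖) * (1 + ‖β₃‖)) ^ 2 := by ring
      _ ≤ (1 + ‖β₀‖) ^ 2 * ((1 + ‖β₁‖) * (1 + ‖β₂‖) * (1 + ‖β₃‖)) ^ 2 := by gcongr; linarith
      _ = T ^ 2 := by rw [hT]; ring
  rw [le_div_iff₀ (by positivity)]
  calc ‖p - β₀ * q‖ * (10 ^ 40 * q ^ 3)
      ≤ ‖p - β₀ * q‖ * (‖β₀ - β₁‖ * ‖β₀ - β₂‖ * ‖β₀ - β₃‖ * T ^ 2 * q ^ 3) := by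
        gcongr
        exact hD.trans (by gcongr)
    _ = ‖p - β₀ * q‖ * ((‖β₀ - β₁‖ * q) * (‖β₀ - β₂‖ * q) * (‖β₀ - β₃‖ * q)) * T ^ 2 := by ring
    _ ≤ ‖p - β₀ * q‖ * ((2 * ‖p - β₁ * q‖) * (2 * ‖p - β₂ * q‖) * (2 * ‖p - β₃ * q‖)) * T ^ 2 := by
        gcongr
    _ = 8 * (‖p - β₀ * q‖ * ‖p - β₁ * q‖ * ‖p - β₂ * q‖ * ‖p - β₃ * q‖) * T ^ 2 := by ring
    _ = 8 * T ^ 2 := by rw [hprod]; ring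

theorem isCoprime_of_abs_quarticEval_eq_one {a b c d e p q : ℤ}
    (h : |quarticEval a b c d e p q| = 1) : IsCoprime p q := by
  unfold quarticEval at h
  rcases (abs_eq zero_le_one).1 h with h | h
  · exact ⟨a * p ^ 3 + b * p ^ 2 * q + c * p * q ^ 2 + d * q ^ 3, e * q ^ 3, by linear_combination h⟩
  · exact ⟨-(a * p ^ 3 + b * p ^ 2 * q + c * p * q ^ 2 + d * q ^ 3), -(e * q ^ 3),
      by linear_combination -h⟩

theorem det_ne_zero_of_isCoprime {p q p' q' : ℤ} (h : IsCoprime p q) (h' : IsCoprime p' q')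
    (hq : 0 < q) (hq' : 0 < q') (hne : (p, q) ≠ (p', q')) : p * q' - p' * q ≠ 0 := by
  intro hdet
  have hdet' : p * q' = p' * q := by linarith
  have h1 : q ∣ q' := h.symm.dvd_of_dvd_mul_left ⟨p', by linarith⟩
  have h2 : q' ∣ q := h'.symm.dvd_of_dvd_mul_left ⟨p, by linarith⟩
  have h3 : q = q' := le_antisymm (Int.le_of_dvd hq' h1) (Int.le_of_dvd hq h2)
  subst h3
  exact hne (by rw [mul_right_cancel₀ hq.ne' hdet'])

/-- A primitive vector `(p, q)` with `q > 0` has a unimodular complement `(r, s)` for which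
`(r - βs) / (p - βq)` is controlled by `q‖p - βq‖`, uniformly in `β`. -/
theorem exists_complement {p q : ℤ} (h : IsCoprime p q) (hq : 0 < q) :
    ∃ r s : ℤ, p * s - q * r = 1 ∧ ∀ β : ℂ, 0 < ‖(p : ℂ) - β * q‖ →
      1 + ‖(r : ℂ) - β * s‖ / ‖(p : ℂ) - β * q‖ ≤
        4 * max 1 (1 / (2 * (q * ‖(p : ℂ) - β * q‖))) := by
  obtain ⟨u, v, huv⟩ := h
  have hmod := Int.emod_add_mul_ediv u q
  have hdet : p * (u % q) - q * -(v + p * (u / q)) = 1 := by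
    linear_combination huv + p * hmod
  refine ⟨-(v + p * (u / q)), u % q, hdet, fun β hβ => ?_⟩
  generalize -(v + p * (u / q)) = r at hdet
  have hs0 := Int.emod_nonneg u hq.ne'
  have hsq := Int.emod_lt_of_pos u hq
  generalize u % q = s at hdet hs0 hsq
  have hq0 : (0 : ℝ) < q := by exact_mod_cast hq
  have hs0' : (0 : ℝ) ≤ s := by exact_mod_cast hs0
  have hsq' : (s : ℝ) ≤ q := by exact_mod_cast hsq.le
  set L := ‖(p : ℂ) - β * q‖ with hL
  have hdetC : (p : ℂ) * s - q * r = 1 := by exact_mod_cast hdet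
  have e : (q : ℂ) * (r - β * s) = s * (p - β * q) - 1 := by linear_combination -hdetC
  have h1 : q * ‖(r : ℂ) - β * s‖ ≤ q * L + 1 := by
    calc q * ‖(r : ℂ) - β * s‖ = ‖(q : ℂ) * (r - β * s)‖ := by
          rw [norm_mul, Complex.norm_intCast, abs_of_pos hq0]
      _ ≤ ‖(s : ℂ) * (p - β * q)‖ + ‖(1 : ℂ)‖ := by rw [e]; exact norm_sub_le _ _
      _ = s * L + 1 := by rw [norm_mul, Complex.norm_intCast, abs_of_nonneg hs0', norm_one]
      _ ≤ q * L + 1 := by gcongr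
  have h2 : ‖(r : ℂ) - β * s‖ / L ≤ 1 + 2 * (1 / (2 * (q * L))) := by
    rw [div_le_iff₀ hβ]
    have : (1 + 2 * (1 / (2 * (q * L)))) * L = (q * L + 1) / q := by field_simp
    rw [this, le_div_iff₀ hq0]
    linarith
  linarith [le_max_left 1 (1 / (2 * (q * L))), le_max_right 1 (1 / (2 * (q * L)))]

/-- A monic irreducible quartic form whose discriminant is large, and whose root product
`∏ (1 + |βᵢ|)` is nearly minimal among its unimodular transforms, represents `±1` at most `44` times
up to sign. -/
theorem card_le_of_monic {b c d e : ℤ} (hirr : Irreducible (quarticPoly 1 b c d e)) {β : Fin 4 → ℂ}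
    (hfac : ∀ z w : ℂ, z ^ 4 + b * z ^ 3 * w + c * z ^ 2 * w ^ 2 + d * z * w ^ 3 + e * w ^ 4 =
      ∏ i, (z - β i * w))
    (hD : 10 ^ 40 ≤ ‖β 0 - β 1‖ * ‖β 0 - β 2‖ * ‖β 0 - β 3‖ *
      (‖β 1 - β 2‖ * ‖β 1 - β 3‖ * ‖β 2 - β 3‖))
    (hmin : ∀ p q r s : ℤ, p * s - q * r = 1 → |quarticEval 1 b c d e p q| = 1 →
      ∏ i, (1 + ‖β i‖) ≤ 2 * ∏ i, (1 + ‖(r : ℂ) - β i * s‖ / ‖(p : ℂ) - β i * q‖))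
    (S : Finset (ℤ × ℤ)) (hS : ∀ x ∈ S, |quarticEval 1 b c d e x.1 x.2| = 1)
    (hnorm : ∀ x ∈ S, 0 < x.2 ∨ x.2 = 0 ∧ 0 < x.1) : S.card ≤ 44 := by
  obtain ⟨hb, hc, hd, he⟩ := coeff_bounds_of_factorization hfac
  set T := ∏ i, (1 + ‖β i‖) with hTdef
  have hT4 : T = (1 + ‖β 0‖) * (1 + ‖β 1‖) * (1 + ‖β 2‖) * (1 + ‖β 3‖) := Fin.prod_univ_four _
  have hβT (i : Fin 4) : 1 + ‖β i‖ ≤ T := by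
    rw [hTdef, ← Finset.mul_prod_erase _ _ (Finset.mem_univ i)]
    refine le_mul_of_one_le_right (by positivity) (Finset.one_le_prod fun j _ => ?_)
    linarith [norm_nonneg (β j)]
  have hT3 : 10 ^ 40 ≤ T ^ 3 := by
    refine hD.trans ?_
    calc _ ≤ ((1 + ‖β 0‖) * (1 + ‖β 1‖)) * ((1 + ‖β 0‖) * (1 + ‖β 2‖)) *
          ((1 + ‖β 0‖) * (1 + ‖β 3‖)) * (((1 + ‖β 1‖) * (1 + ‖β 2‖)) *
          ((1 + ‖β 1‖) * (1 + ‖β 3‖)) * ((1 + ‖β 2‖) * (1 + ‖β 3‖))) := by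
          gcongr <;> exact norm_sub_le_one_add_mul _ _
      _ = T ^ 3 := by rw [hT4]; ring
  have hT512 : 512 < T := by
    by_contra! h
    have := pow_le_pow_left₀ (by linarith [norm_nonneg (β 0), hβT 0]) h 3
    norm_num at this hT3
    linarith
  have hprod (x) (hx : x ∈ S) : ∏ i, ‖(x.1 : ℂ) - β i * x.2‖ = 1 := by
    rw [← norm_prod, ← hfac]
    have e1 : (x.1 : ℂ) ^ 4 + b * x.1 ^ 3 * x.2 + c * x.1 ^ 2 * x.2 ^ 2 + d * x.1 * x.2 ^ 3 +
        e * x.2 ^ 4 = ((quarticEval 1 b c d e x.1 x.2 : ℤ) : ℂ) := by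
      unfold quarticEval; push_cast; ring
    rw [e1, Complex.norm_intCast]
    exact_mod_cast hS x hx
  have hpos (x) (hx : x ∈ S) (i) : 0 < ‖(x.1 : ℂ) - β i * x.2‖ := by
    refine lt_of_le_of_ne (norm_nonneg _) fun h => ?_
    have := hprod x hx
    rw [Finset.prod_eq_zero (Finset.mem_univ i) h.symm] at this
    exact zero_ne_one this
  have hcop (x) (hx : x ∈ S) := isCoprime_of_abs_quarticEval_eq_one (hS x hx)
  have hroot (i : Fin 4) : β i ^ 4 + b * β i ^ 3 + c * β i ^ 2 + d * β i + e = 0 := by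
    have h := hfac (β i) 1
    rw [Finset.prod_eq_zero (Finset.mem_univ i) (by ring)] at h
    rw [← h]; ring
  set Y := (T / 512) ^ 2 with hY
  set S₀ := S.filter fun x => x.2 = 0 with hS₀
  set S₁ := S.filter fun x => 0 < x.2 ∧ (x.2 : ℝ) < Y with hS₁
  set K : Fin 4 → Finset (ℤ × ℤ) := fun i => S.filter fun x => 0 < x.2 ∧ Y ≤ (x.2 : ℝ) ∧
    ∀ j, ‖(x.1 : ℂ) - β i * x.2‖ ≤ ‖(x.1 : ℂ) - β j * x.2‖ with hK
  have hcover : S ⊆ S₀ ∪ S₁ ∪ Finset.univ.biUnion K := by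
    intro x hx
    simp only [hS₀, hS₁, hK, Finset.mem_union, Finset.mem_filter, Finset.mem_biUnion,
      Finset.mem_univ, true_and, hx]
    rcases hnorm x hx with h | h
    · rcases lt_or_ge (x.2 : ℝ) Y with h' | h'
      · exact Or.inl (Or.inr ⟨h, h'⟩)
      · obtain ⟨i, hi⟩ := Finite.exists_min fun i => ‖(x.1 : ℂ) - β i * x.2‖
        exact Or.inr ⟨i, h, h', hi⟩
    · exact Or.inl (Or.inl h.1)
  have hdet (x) (hx : x ∈ S) (hx2 : 0 < x.2) (y) (hy : y ∈ S) (hy2 : 0 < y.2) (hxy : x ≠ y) :=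
    det_ne_zero_of_isCoprime (hcop x hx) (hcop y hy) hx2 hy2 hxy
  have hcard₀ : S₀.card ≤ 1 := by
    refine Finset.card_le_one.2 ?_
    have key : ∀ x ∈ S₀, x = (1, 0) := by
      intro x hx
      obtain ⟨hxS, hx2⟩ := Finset.mem_filter.1 hx
      have hunit := hcop x hxS
      rw [hx2, isCoprime_zero_right, Int.isUnit_iff] at hunit
      have h1 := (hnorm x hxS).resolve_left (by omega)
      exact Prod.ext (by dsimp only; omega) hx2
    intro x hx y hy
    rw [key x hx, key y hy]
  have hcard₁ : S₁.card ≤ 11 := by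
    have hm (x) (hx : x ∈ S₁) := Finset.mem_filter.1 hx
    refine card_small_le hT512 S₁ (fun x hx => (hm x hx).2.1) (fun x hx => (hm x hx).2.2)
      (fun x hx y hy => hdet x (hm x hx).1 (hm x hx).2.1 y (hm y hy).1 (hm y hy).2.1)
      (fun x hx => hpos x (hm x hx).1) fun x hx => ?_
    obtain ⟨hxS, hx2, -⟩ := hm x hx
    obtain ⟨r, s, hrs, hle⟩ := exists_complement (hcop x hxS) hx2
    have h1 := hmin _ _ r s hrs (hS x hxS)
    have h2 : ∏ i, (1 + ‖(r : ℂ) - β i * s‖ / ‖(x.1 : ℂ) - β i * x.2‖) ≤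
        ∏ i, (4 * max 1 (1 / (2 * (x.2 * ‖(x.1 : ℂ) - β i * x.2‖)))) :=
      Finset.prod_le_prod (fun i _ => by positivity) fun i _ => hle (β i) (hpos x hxS i)
    rw [Finset.prod_mul_distrib, Finset.prod_const, Finset.card_univ, Fintype.card_fin] at h2
    linarith
  have hcardK (i : Fin 4) : (K i).card ≤ 8 := by
    have hm (x) (hx : x ∈ K i) := Finset.mem_filter.1 hx
    refine card_large_le hirr (hroot i) hT3 hb hc hd he (hβT i) (K i)
      (fun x hx => (hm x hx).2.2.1)
      (fun x hx y hy => hdet x (hm x hx).1 (hm x hx).2.1 y (hm y hy).1 (hm y hy).2.1)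
      fun x hx => ?_
    obtain ⟨hxS, hx2, -, hxmin⟩ := hm x hx
    have hx2' : (0 : ℝ) < x.2 := by exact_mod_cast hx2
    have hp := hprod x hxS
    rw [Fin.prod_univ_four] at hp
    have h01 := norm_sub_rev (β 0) (β 1)
    have h02 := norm_sub_rev (β 0) (β 2)
    have h03 := norm_sub_rev (β 0) (β 3)
    have h12 := norm_sub_rev (β 1) (β 2)
    have h13 := norm_sub_rev (β 1) (β 3)
    have h23 := norm_sub_rev (β 2) (β 3)
    have hcast : (x.2 : ℂ) = ((x.2 : ℝ) : ℂ) := by push_cast; rfl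
    rw [hcast] at hp hxmin ⊢
    fin_cases i
    · refine norm_min_form_le (β₁ := β 1) (β₂ := β 2) (β₃ := β 3) hx2' hT4 ?_ ?_
        (hxmin 1) (hxmin 2) (hxmin 3)
      · exact hD
      · exact hp
    · refine norm_min_form_le (β₁ := β 0) (β₂ := β 2) (β₃ := β 3) hx2' (hT4.trans (by dsimp; ring))
        ?_ ?_ (hxmin 0) (hxmin 2) (hxmin 3)
      · refine hD.trans_eq ?_; dsimp; rw [← h01]; ring
      · rw [← hp]; dsimp; ring
    · refine norm_min_form_le (β₁ := β 0) (β₂ := β 1) (β₃ := β 3) hx2' (hT4.trans (by dsimp; ring))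
        ?_ ?_ (hxmin 0) (hxmin 1) (hxmin 3)
      · refine hD.trans_eq ?_; dsimp; rw [← h02, ← h12]; ring
      · rw [← hp]; dsimp; ring
    · refine norm_min_form_le (β₁ := β 0) (β₂ := β 1) (β₃ := β 2) hx2' (hT4.trans (by dsimp; ring))
        ?_ ?_ (hxmin 0) (hxmin 1) (hxmin 2)
      · refine hD.trans_eq ?_; dsimp; rw [← h03, ← h13, ← h23]; ring
      · rw [← hp]; dsimp; ring
  have hcardU : (Finset.univ.biUnion K).card ≤ 32 :=
    Finset.card_biUnion_le.trans ((Finset.sum_le_sum fun i _ => hcardK i).trans_eq (by simp))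
  have h1 := Finset.card_le_card hcover
  have h2 := Finset.card_union_le (S₀ ∪ S₁) (Finset.univ.biUnion K)
  have h3 := Finset.card_union_le S₀ S₁
  omega

open Polynomial in
/-- Over `ℂ` a binary quartic form with nonzero leading coefficient splits into linear forms. -/
theorem exists_factorization {a : ℤ} (ha : a ≠ 0) (b c d e : ℤ) :
    ∃ α : Fin 4 → ℂ,
      (∀ z w : ℂ, a * z ^ 4 + b * z ^ 3 * w + c * z ^ 2 * w ^ 2 + d * z * w ^ 3 + e * w ^ 4 =
        a * ∏ i, (z - α i * w)) ∧
      (quarticDisc a b c d e : ℂ) = a ^ 6 * ((α 0 - α 1) * (α 0 - α 2) * (α 0 - α 3) *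
        ((α 1 - α 2) * (α 1 - α 3) * (α 2 - α 3))) ^ 2 := by
  set P : ℂ[X] := C (a : ℂ) * X ^ 4 + C (b : ℂ) * X ^ 3 + C (c : ℂ) * X ^ 2 + C (d : ℂ) * X +
    C (e : ℂ) with hP
  have ha' : (a : ℂ) ≠ 0 := by exact_mod_cast ha
  have hdeg : P.natDegree = 4 := by rw [hP]; compute_degree!
  have hlead : P.leadingCoeff = a := by
    rw [leadingCoeff, hdeg, hP]
    simp [-map_intCast]
  have hsplit := (IsAlgClosed.splits P)
  have hcard : Multiset.card P.roots = 4 := by rw [← hdeg]; exact hsplit.natDegree_eq_card_roots.symm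
  have hprod := hsplit.eq_prod_roots
  obtain ⟨l, hl⟩ := Quotient.exists_rep P.roots
  rw [← hl] at hcard hprod
  match l, hcard with
  | [x₀, x₁, x₂, x₃], _ =>
    rw [hlead] at hprod
    have hz (z : ℂ) : a * z ^ 4 + b * z ^ 3 + c * z ^ 2 + d * z + e =
        a * ((z - x₀) * (z - x₁) * (z - x₂) * (z - x₃)) := by
      have := congrArg (eval z) hprod
      rw [hP] at this
      simp at this
      rw [this]; ring
    have h0 := hz 0
    have h1 := hz 1
    have h2 := hz (-1)
    have h3 := hz 2
    have he : (e : ℂ) = a * (x₀ * x₁ * x₂ * x₃) := by linear_combination h0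
    have hc : (c : ℂ) = a * (x₀ * x₁ + x₀ * x₂ + x₀ * x₃ + x₁ * x₂ + x₁ * x₃ + x₂ * x₃) := by
      linear_combination h1 / 2 + h2 / 2 - h0
    have hb : (b : ℂ) = -a * (x₀ + x₁ + x₂ + x₃) := by
      linear_combination (h3 - h0 - 4 * (h1 / 2 + h2 / 2 - h0)) / 6 - (h1 / 2 - h2 / 2) / 3
    have hd : (d : ℂ) = -a * (x₀ * x₁ * x₂ + x₀ * x₁ * x₃ + x₀ * x₂ * x₃ + x₁ * x₂ * x₃) := by
      linear_combination (h1 - h2) / 2 - hb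
    refine ⟨![x₀, x₁, x₂, x₃], fun z w => ?_, ?_⟩
    · rw [Fin.prod_univ_four, hb, hc, hd, he]
      simp
      ring
    · unfold quarticDisc
      push_cast
      rw [hb, hc, hd, he]
      simp
      ring

/-- A unimodular substitution sending `(1, 0)` to a point where the form takes a value `ε = ±1`
yields, after multiplication by `ε`, a monic form. -/
theorem exists_monic_substitution {a b c d e p q r s ε : ℤ} (h : ε * quarticEval a b c d e p q = 1) :
    ∃ b' c' d' e' : ℤ,
      (∀ X Y : ℤ, quarticEval 1 b' c' d' e' X Y =
        ε * quarticEval a b c d e (X * p + Y * r) (X * q + Y * s)) ∧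
      ∀ z w : ℂ, z ^ 4 + b' * z ^ 3 * w + c' * z ^ 2 * w ^ 2 + d' * z * w ^ 3 + e' * w ^ 4 =
        ε * (a * (z * p + w * r) ^ 4 + b * (z * p + w * r) ^ 3 * (z * q + w * s) +
          c * (z * p + w * r) ^ 2 * (z * q + w * s) ^ 2 +
          d * (z * p + w * r) * (z * q + w * s) ^ 3 + e * (z * q + w * s) ^ 4) := by
  unfold quarticEval at h
  refine ⟨ε * (a * (4 * p ^ 3 * r) + b * (p ^ 3 * s + 3 * p ^ 2 * r * q) +
      c * (2 * p * r * q ^ 2 + 2 * p ^ 2 * q * s) + d * (r * q ^ 3 + 3 * p * q ^ 2 * s) +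
      e * (4 * q ^ 3 * s)),
    ε * (a * (6 * p ^ 2 * r ^ 2) + b * (3 * p ^ 2 * r * s + 3 * p * r ^ 2 * q) +
      c * (p ^ 2 * s ^ 2 + r ^ 2 * q ^ 2 + 4 * p * r * q * s) +
      d * (3 * p * q * s ^ 2 + 3 * r * q ^ 2 * s) + e * (6 * q ^ 2 * s ^ 2)),
    ε * (a * (4 * p * r ^ 3) + b * (q * r ^ 3 + 3 * p * r ^ 2 * s) +
      c * (2 * p * r * s ^ 2 + 2 * r ^ 2 * q * s) + d * (p * s ^ 3 + 3 * r * q * s ^ 2) +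
      e * (4 * q * s ^ 3)),
    ε * (a * r ^ 4 + b * r ^ 3 * s + c * r ^ 2 * s ^ 2 + d * r * s ^ 3 + e * s ^ 4),
    fun X Y => ?_, fun z w => ?_⟩
  · unfold quarticEval
    linear_combination -X ^ 4 * h
  · have h' : (ε : ℂ) * (a * p ^ 4 + b * p ^ 3 * q + c * p ^ 2 * q ^ 2 + d * p * q ^ 3 + e * q ^ 4) =
        1 := by exact_mod_cast h
    push_cast
    linear_combination -z ^ 4 * h'

open Polynomial IntermediateField in
/-- Irreducibility of a quartic is inherited by a monic quartic vanishing at a unimodular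
transform of one of its roots. -/
theorem irreducible_of_moebius_root {a b c d e b' c' d' e' p q r s : ℤ} (ha : a ≠ 0)
    (hirr : Irreducible (quarticPoly a b c d e)) {α β : ℂ}
    (hα : aeval α (quarticPoly a b c d e) = 0) (hdet : p * s - q * r = 1)
    (hne : (p : ℂ) - α * q ≠ 0) (hβ : β = -((r : ℂ) - α * s) / (p - α * q))
    (hβ' : aeval β (quarticPoly 1 b' c' d' e') = 0) :
    Irreducible (quarticPoly 1 b' c' d' e') := by
  have hdetC : (p : ℂ) * s - q * r = 1 := by exact_mod_cast hdet
  have hmin : (minpoly ℚ α).natDegree = 4 := by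
    rw [← minpoly.eq_of_irreducible hirr hα, natDegree_mul_C, natDegree_quarticPoly ha]
    exact inv_ne_zero (leadingCoeff_ne_zero.2 hirr.ne_zero)
  have hmonic : (quarticPoly 1 b' c' d' e').Monic := by
    unfold quarticPoly; monicity!
  have hαint : IsIntegral ℚ α := isAlgebraic_iff_isIntegral.1 ⟨_, hirr.ne_zero, hα⟩
  have hβint : IsIntegral ℚ β := ⟨_, hmonic, hβ'⟩
  have h_int (K : IntermediateField ℚ ℂ) (n : ℤ) : (n : ℂ) ∈ K := intCast_mem K n
  have hadj : ℚ⟮β⟯ = ℚ⟮α⟯ := by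
    have hsβ : (s : ℂ) + β * q = 1 / (p - α * q) := by
      rw [hβ]; field_simp; linear_combination hdetC
    have hαβ : α = (r + β * p) / (s + β * q) := by
      rw [hsβ, hβ]; field_simp; linear_combination -α * hdetC
    refine le_antisymm (adjoin_simple_le_iff.2 ?_) (adjoin_simple_le_iff.2 ?_)
    · have hm := mem_adjoin_simple_self ℚ α
      rw [hβ]
      exact div_mem (neg_mem (sub_mem (h_int _ r) (mul_mem hm (h_int _ s))))
        (sub_mem (h_int _ p) (mul_mem hm (h_int _ q)))
    · have hm := mem_adjoin_simple_self ℚ β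
      rw [hαβ]
      exact div_mem (add_mem (h_int _ r) (mul_mem hm (h_int _ p)))
        (add_mem (h_int _ s) (mul_mem hm (h_int _ q)))
  have hdeg : (minpoly ℚ β).natDegree = 4 := by
    rw [← adjoin.finrank hβint, hadj, adjoin.finrank hαint, hmin]
  have heq : minpoly ℚ β = quarticPoly 1 b' c' d' e' :=
    (eq_of_monic_of_dvd_of_natDegree_le (minpoly.monic hβint) hmonic (minpoly.dvd ℚ β hβ')
      (by rw [hdeg, natDegree_quarticPoly one_ne_zero])).symm
  rw [← heq]
  exact minpoly.irreducible hβint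

theorem exists_finset_card_le {ι : Type*} {A : Set ι} {n : ℕ}
    (h : ∀ S : Finset ι, ↑S ⊆ A → S.card ≤ n) : ∃ S : Finset ι, S.card ≤ n ∧ ↑S = A := by
  have hfin : A.Finite := by
    by_contra hinf
    obtain ⟨S, hS, hcard⟩ := Set.Infinite.exists_subset_card_eq hinf (n + 1)
    have := h S hS
    omega
  exact ⟨hfin.toFinset, h _ (by simp), by simp⟩

/-- An admissible form, transformed by a unimodular matrix with first column a solution of
`|f| = 1` chosen to nearly minimize the root product, satisfies the hypotheses of
`card_le_of_monic`. -/
theorem exists_reduced_monic {a b c d e : ℤ} (ha : a ≠ 0) (hirr : Irreducible (quarticPoly a b c d e))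
    (hD : 271336712 * 10 ^ 72 ≤ |quarticDisc a b c d e|)
    (hsol : ∃ p q : ℤ, |quarticEval a b c d e p q| = 1) :
    ∃ (b' c' d' e' p q r s : ℤ) (β : Fin 4 → ℂ), p * s - q * r = 1 ∧
      (∀ X Y : ℤ, |quarticEval 1 b' c' d' e' X Y| =
        |quarticEval a b c d e (X * p + Y * r) (X * q + Y * s)|) ∧
      Irreducible (quarticPoly 1 b' c' d' e') ∧
      (∀ z w : ℂ, z ^ 4 + b' * z ^ 3 * w + c' * z ^ 2 * w ^ 2 + d' * z * w ^ 3 + e' * w ^ 4 =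
        ∏ i, (z - β i * w)) ∧
      10 ^ 40 ≤ ‖β 0 - β 1‖ * ‖β 0 - β 2‖ * ‖β 0 - β 3‖ *
        (‖β 1 - β 2‖ * ‖β 1 - β 3‖ * ‖β 2 - β 3‖) ∧
      ∀ P Q R S : ℤ, P * S - Q * R = 1 → |quarticEval 1 b' c' d' e' P Q| = 1 →
        ∏ i, (1 + ‖β i‖) ≤ 2 * ∏ i, (1 + ‖(R : ℂ) - β i * S‖ / ‖(P : ℂ) - β i * Q‖) := by
  obtain ⟨α, hfac, hdisc⟩ := exists_factorization ha b c d e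
  set W : Set ℝ := {t | ∃ p q r s : ℤ, p * s - q * r = 1 ∧ |quarticEval a b c d e p q| = 1 ∧
    ∏ i, (1 + ‖(r : ℂ) - α i * s‖ / ‖(p : ℂ) - α i * q‖) = t} with hW
  have hWne : W.Nonempty := by
    obtain ⟨p, q, hpq⟩ := hsol
    obtain ⟨u, v, huv⟩ := isCoprime_of_abs_quarticEval_eq_one hpq
    exact ⟨_, p, q, -v, u, by linear_combination huv, hpq, rfl⟩
  have hW1 : ∀ t ∈ W, 1 ≤ t := by
    rintro t ⟨p, q, r, s, -, -, rfl⟩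
    exact Finset.one_le_prod fun i _ => le_add_of_nonneg_right (by positivity)
  have hWinf : 1 ≤ sInf W := le_csInf hWne hW1
  obtain ⟨t, ⟨p, q, r, s, hdet, hpq, rfl⟩, hlt⟩ :=
    exists_lt_of_csInf_lt hWne (show sInf W < 2 * sInf W by linarith)
  have hWmin : ∀ t ∈ W, ∏ i, (1 + ‖(r : ℂ) - α i * s‖ / ‖(p : ℂ) - α i * q‖) ≤ 2 * t :=
    fun t ht => hlt.le.trans (by linarith [csInf_le ⟨1, hW1⟩ ht])
  obtain ⟨ε, hε, hεpq⟩ : ∃ ε : ℤ, |ε| = 1 ∧ ε * quarticEval a b c d e p q = 1 :=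
    ⟨quarticEval a b c d e p q, hpq, by rw [← abs_mul_abs_self, hpq, one_mul]⟩
  obtain ⟨b', c', d', e', h_int, hcomplex⟩ := exists_monic_substitution (r := r) (s := s) hεpq
  have hdetC : (p : ℂ) * s - q * r = 1 := by exact_mod_cast hdet
  have hlam : (ε : ℂ) * (a * ∏ i, (p - α i * q)) = 1 := by
    rw [← hfac]
    unfold quarticEval at hεpq
    exact_mod_cast hεpq
  have hne (i : Fin 4) : (p : ℂ) - α i * q ≠ 0 := by
    intro h
    rw [Finset.prod_eq_zero (Finset.mem_univ i) h, mul_zero, mul_zero] at hlam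
    exact zero_ne_one hlam
  set β : Fin 4 → ℂ := fun i => -((r : ℂ) - α i * s) / (p - α i * q) with hβ
  have hlin (i : Fin 4) (z w : ℂ) :
      (z * p + w * r) - α i * (z * q + w * s) = (p - α i * q) * (z - β i * w) := by
    have := hne i
    simp only [hβ]
    field_simp
    ring
  have hfac' (z w : ℂ) : z ^ 4 + b' * z ^ 3 * w + c' * z ^ 2 * w ^ 2 + d' * z * w ^ 3 + e' * w ^ 4 =
      ∏ i, (z - β i * w) := by
    rw [hcomplex, hfac, Finset.prod_congr rfl fun i _ => hlin i z w, Finset.prod_mul_distrib,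
      ← mul_assoc (a : ℂ), ← mul_assoc, hlam, one_mul]
  have habs (X Y : ℤ) : |quarticEval 1 b' c' d' e' X Y| =
      |quarticEval a b c d e (X * p + Y * r) (X * q + Y * s)| := by
    rw [h_int, abs_mul, hε, one_mul]
  refine ⟨b', c', d', e', p, q, r, s, β, hdet, habs, ?_, hfac', ?_, ?_⟩
  · refine irreducible_of_moebius_root ha hirr (α := α 0) (β := β 0) ?_ hdet (hne 0) rfl ?_
    · have h := hfac (α 0) 1
      rw [Finset.prod_eq_zero (Finset.mem_univ 0) (by ring), mul_zero] at h
      rw [aeval_quarticPoly, ← h]; ring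
    · have h := hfac' (β 0) 1
      rw [Finset.prod_eq_zero (Finset.mem_univ 0) (by ring)] at h
      rw [aeval_quarticPoly, ← h]; push_cast; ring
  · have hdiff (i j : Fin 4) : (β i - β j) * ((p - α i * q) * (p - α j * q)) = α i - α j := by
      have hmul (k : Fin 4) : β k * (p - α k * q) = -(r - α k * s) := div_mul_cancel₀ _ (hne k)
      linear_combination (p - α j * q) * hmul i - (p - α i * q) * hmul j + (α i - α j) * hdetC
    rw [Fin.prod_univ_four] at hlam
    have hsq : (quarticDisc a b c d e : ℂ) = ((β 0 - β 1) * (β 0 - β 2) * (β 0 - β 3) *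
        ((β 1 - β 2) * (β 1 - β 3) * (β 2 - β 3))) ^ 2 := by
      have hε6 : (ε : ℂ) ^ 6 = 1 := by
        have h2 : ε ^ 2 = 1 := by rw [← sq_abs, hε, one_pow]
        have h6 : ε ^ 6 = 1 := by rw [show 6 = 2 * 3 from rfl, pow_mul, h2, one_pow]
        exact_mod_cast h6
      rw [hdisc, ← hdiff 0 1, ← hdiff 0 2, ← hdiff 0 3, ← hdiff 1 2, ← hdiff 1 3, ← hdiff 2 3]
      generalize β 0 - β 1 = t₁
      generalize β 0 - β 2 = t₂
      generalize β 0 - β 3 = t₃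
      generalize β 1 - β 2 = t₄
      generalize β 1 - β 3 = t₅
      generalize β 2 - β 3 = t₆
      generalize (p : ℂ) - α 0 * q = l₀ at *
      generalize (p : ℂ) - α 1 * q = l₁ at *
      generalize (p : ℂ) - α 2 * q = l₂ at *
      generalize (p : ℂ) - α 3 * q = l₃ at *
      have h6 : ((ε : ℂ) * (a * (l₀ * l₁ * l₂ * l₃))) ^ 6 = 1 := by rw [hlam, one_pow]
      have h7 : (a * (l₀ * l₁ * l₂ * l₃)) ^ 6 = 1 := by
        rw [mul_pow, hε6, one_mul] at h6; exact h6
      linear_combination (t₁ * t₂ * t₃ * (t₄ * t₅ * t₆)) ^ 2 * h7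
    have hnorm := congrArg norm hsq
    rw [Complex.norm_intCast, norm_pow] at hnorm
    simp only [norm_mul] at hnorm
    have hD' : (271336712 * 10 ^ 72 : ℝ) ≤ |(quarticDisc a b c d e : ℝ)| := by exact_mod_cast hD
    rw [hnorm] at hD'
    refine le_of_sq_le_sq (le_trans ?_ hD') (by positivity)
    norm_num
  · intro P Q R S hPS hPQ
    have hmem : ∏ i, (1 + ‖(R : ℂ) - β i * S‖ / ‖(P : ℂ) - β i * Q‖) ∈ W := by
      refine ⟨P * p + Q * r, P * q + Q * s, R * p + S * r, R * q + S * s, ?_, ?_, ?_⟩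
      · linear_combination hdet * (P * S - Q * R) + hPS
      · rw [← habs, hPQ]
      · refine Finset.prod_congr rfl fun i _ => ?_
        push_cast
        rw [hlin, hlin, norm_mul, norm_mul, mul_div_mul_left _ _ (norm_ne_zero_iff.2 (hne i))]
    refine le_trans (le_of_eq ?_) (hWmin _ hmem)
    refine Finset.prod_congr rfl fun i _ => ?_
    simp only [hβ]
    rw [norm_div, norm_neg]

/-- An irreducible integral binary quartic form with `|Disc(f)| ≥ 2.71336712 × 10⁸⁰`
represents `±1` at most 44 times, with `(x,y) ∼ (-x,-y)` identified. -/
theorem quartic_thue_huge_disc_at_most_44_solutions (a b c d e : ℤ)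
    (ha : a ≠ 0) (hirr : Irreducible (quarticPoly a b c d e))
    (hD : 271336712 * 10 ^ 72 ≤ |quarticDisc a b c d e|) :
    ∃ S : Finset (ℤ × ℤ), S.card ≤ 44 ∧
      ∀ x y : ℤ, quarticEval a b c d e x y = 1 ∨ quarticEval a b c d e x y = -1 →
        (x, y) ∈ S ∨ (-x, -y) ∈ S := by
  by_cases hsol : ∃ p q : ℤ, |quarticEval a b c d e p q| = 1
  swap
  · exact ⟨∅, by simp, fun x y h => absurd ⟨x, y, (abs_eq zero_le_one).2 h⟩ hsol⟩
  obtain ⟨b', c', d', e', p, q, r, s, β, hdet, habs, hirr', hfac, hD', hmin⟩ :=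
    exists_reduced_monic ha hirr hD hsol
  obtain ⟨S, hcard, hS⟩ := exists_finset_card_le (n := 44)
    (A := {x : ℤ × ℤ | |quarticEval 1 b' c' d' e' x.1 x.2| = 1 ∧ (0 < x.2 ∨ x.2 = 0 ∧ 0 < x.1)})
    fun S hS => card_le_of_monic hirr' hfac hD' hmin S (fun x hx => (hS hx).1) fun x hx => (hS hx).2
  have hmem (X Y : ℤ) (h : |quarticEval 1 b' c' d' e' X Y| = 1) (h' : 0 < Y ∨ Y = 0 ∧ 0 < X) :
      (X, Y) ∈ S := by
    rw [← Finset.mem_coe, hS]; exact ⟨h, h'⟩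
  refine ⟨S.image fun x => (x.1 * p + x.2 * r, x.1 * q + x.2 * s),
    Finset.card_image_le.trans hcard, fun x y hxy => ?_⟩
  obtain ⟨X, hX⟩ : ∃ X, X = s * x - r * y := ⟨_, rfl⟩
  obtain ⟨Y, hY⟩ : ∃ Y, Y = p * y - q * x := ⟨_, rfl⟩
  have hx : X * p + Y * r = x := by rw [hX, hY]; linear_combination x * hdet
  have hy : X * q + Y * s = y := by rw [hX, hY]; linear_combination y * hdet
  have hXY : |quarticEval 1 b' c' d' e' X Y| = 1 := by
    rw [habs, hx, hy]; exact (abs_eq zero_le_one).2 hxy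
  have hneg : |quarticEval 1 b' c' d' e' (-X) (-Y)| = 1 := by
    have heven : quarticEval 1 b' c' d' e' (-X) (-Y) = quarticEval 1 b' c' d' e' X Y := by
      unfold quarticEval
      ring
    rw [heven, hXY]
  have hne : ¬(X = 0 ∧ Y = 0) := by
    rintro ⟨rfl, rfl⟩
    simp [quarticEval] at hXY
  by_cases hpos : 0 < Y ∨ Y = 0 ∧ 0 < X
  · exact Or.inl (Finset.mem_image.2 ⟨(X, Y), hmem X Y hXY hpos, by rw [hx, hy]⟩)
  · refine Or.inr (Finset.mem_image.2 ⟨(-X, -Y), hmem _ _ hneg (by omega), ?_⟩)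
    rw [← hx, ← hy]
    exact Prod.ext (by dsimp only; ring) (by dsimp only; ring)
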